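/- For every integer n ≥ 3 there exists an atriodic continuum which is simple-n-od-like but not simple-(n−1)-od-like. -/

import Mathlib

/-! ## Simple-n-ods in the plane, likeness, arcs, triods, indecomposability -/

/-- The simple-`n`-od `T_n ⊆ ℂ`: the union of `n` unit segments emanating from `0`. -/
def simpleOdSet (n : ℕ) : Set ℂ :=
  {z | ∃ t : ℝ, ∃ k : ℕ, t ∈ Set.Icc (0:ℝ) 1 ∧ k < n ∧
    z = (t : ℂ) * Complex.exp (2 * Real.pi * Complex.I * (k : ℂ) / (n : ℂ))}

/-- `X` is `Y`-like: for every `ε > 0` there is a continuous surjection `X → Y`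
all of whose point-inverses have diameter `< ε`. -/
def IsLike (X Y : Type*) [MetricSpace X] [MetricSpace Y] : Prop :=
  ∀ ε : ℝ, 0 < ε → ∃ g : X → Y, Continuous g ∧ Function.Surjective g ∧
    ∀ y : Y, Metric.diam (g ⁻¹' {y}) < ε

/-- `A` is an arc: it is homeomorphic to `[0,1]`. -/
def IsArcSet {K : Type*} [TopologicalSpace K] (A : Set K) : Prop :=
  Nonempty (↥A ≃ₜ ↥(Set.Icc (0:ℝ) 1))

/-- Two sets are mutually separated: neither meets the closure of the other. -/
def MutuallySeparated {K : Type*} [TopologicalSpace K] (A B : Set K) : Prop :=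
  A ∩ closure B = ∅ ∧ closure A ∩ B = ∅

/-- The (sub)continuum `C` is a triod: it contains a subcontinuum `M` such that
`C \ M` is the union of three nonempty pairwise mutually separated sets. -/
def IsTriodSet {K : Type*} [TopologicalSpace K] (C : Set K) : Prop :=
  ∃ M A B D : Set K, IsCompact M ∧ IsConnected M ∧ M ⊆ C ∧
    A.Nonempty ∧ B.Nonempty ∧ D.Nonempty ∧ C \ M = A ∪ B ∪ D ∧
    MutuallySeparated A B ∧ MutuallySeparated A D ∧ MutuallySeparated B D

/-- A space is atriodic if it contains no subcontinuum which is a triod. -/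
def AtriodicSpace (K : Type*) [TopologicalSpace K] : Prop :=
  ∀ C : Set K, IsCompact C → IsConnected C → ¬ IsTriodSet C

/-- A space is indecomposable if it is not the union of two proper subcontinua. -/
def IndecomposableSpace (K : Type*) [TopologicalSpace K] : Prop :=
  ¬ ∃ A B : Set K, IsCompact A ∧ IsConnected A ∧ IsCompact B ∧ IsConnected B ∧
    A ≠ Set.univ ∧ B ≠ Set.univ ∧ A ∪ B = Set.univ

/-! ### Cells of a discrete spider -/

/-- The cells of a discrete spider with `m` legs: `none` is the centre, `some (r, k)` is the
cell at distance `k + 1` from the centre on leg `r`. -/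
abbrev Cell (m : ℕ) := Option (Fin m × ℕ)

namespace Cell

variable {m : ℕ}

/-- The cell at distance `k` from the centre on leg `r`. -/
def mk (r : Fin m) : ℕ → Cell m
  | 0 => none
  | k + 1 => some (r, k)

/-- Signed distance from the centre, positive on leg `r`. -/
def sgn (r : Fin m) : Cell m → ℤ
  | none => 0
  | some (r', k) => if r' = r then (k : ℤ) + 1 else -((k : ℤ) + 1)

/-- Equal or neighbouring cells. -/
def Adj (c c' : Cell m) : Prop :=
  c = c' ∨ ∃ r k, (c = mk r k ∧ c' = mk r (k + 1)) ∨ (c = mk r (k + 1) ∧ c' = mk r k)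

lemma Adj.symm {c c' : Cell m} (h : Adj c c') : Adj c' c := by
  rcases h with h | ⟨r, k, h | h⟩
  · exact Or.inl h.symm
  · exact Or.inr ⟨r, k, Or.inr h.symm⟩
  · exact Or.inr ⟨r, k, Or.inl h.symm⟩

lemma Adj.refl (c : Cell m) : Adj c c := Or.inl rfl

@[simp] lemma sgn_mk (r : Fin m) (k : ℕ) : sgn r (mk r k) = k := by
  cases k <;> simp [mk, sgn]

lemma eq_mk_of_sgn {r : Fin m} {c : Cell m} {k : ℕ} (h : sgn r c = k) : c = mk r k := by
  rcases c with _ | ⟨r', k'⟩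
  · simp only [sgn] at h
    obtain rfl : k = 0 := by omega
    rfl
  · simp only [sgn] at h
    split_ifs at h with hr
    · obtain rfl : k = k' + 1 := by omega
      subst hr; rfl
    · omega

lemma sgn_mk_ne {r r' : Fin m} (h : r' ≠ r) (k : ℕ) : sgn r (mk r' k) = -k := by
  cases k with
  | zero => simp [mk, sgn]
  | succ k => simp [mk, sgn, h]

lemma Adj.sgn_le {c c' : Cell m} (h : Adj c c') (r : Fin m) : |sgn r c - sgn r c'| ≤ 1 := by
  rcases h with rfl | ⟨r', k, ⟨rfl, rfl⟩ | ⟨rfl, rfl⟩⟩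
  · simp
  all_goals
    by_cases hr : r' = r
    · subst hr; simp
    · simp [sgn_mk_ne hr]

lemma exists_eq_mk (r₀ : Fin m) (c : Cell m) : ∃ r k, c = mk r k := by
  rcases c with _ | ⟨r, k⟩
  · exact ⟨r₀, 0, rfl⟩
  · exact ⟨r, k + 1, rfl⟩

lemma mk_succ_inj {r r' : Fin m} {k k' : ℕ} (h : mk r k = mk r' (k' + 1)) :
    r = r' ∧ k = k' + 1 := by
  cases k with
  | zero => simp [mk] at h
  | succ k => simp [mk] at h; exact ⟨h.1, by omega⟩

/-- The neighbours of a cell that is not the centre. -/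
lemma Adj.eq_of_ne {r : Fin m} {k : ℕ} {c : Cell m} (h : Adj (mk r (k + 1)) c)
    (hne : c ≠ mk r (k + 1)) : c = mk r k ∨ c = mk r (k + 2) := by
  rcases h with h | ⟨r', k', ⟨h, rfl⟩ | ⟨h, rfl⟩⟩
  · exact absurd h.symm hne
  · obtain ⟨rfl, rfl⟩ := mk_succ_inj h.symm
    exact Or.inr rfl
  · obtain ⟨rfl, h⟩ := mk_succ_inj h
    obtain rfl : k = k' := by omega
    exact Or.inl rfl

end Cell

/-- Discrete intermediate value theorem for integer sequences with steps at most one. -/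
lemma exists_eq_of_steps {u : ℕ → ℤ} {v : ℤ} : ∀ {s t : ℕ}, s ≤ t →
    (∀ k, s ≤ k → k < t → |u k - u (k + 1)| ≤ 1) → u s ≤ v → v ≤ u t →
    ∃ k, s ≤ k ∧ k ≤ t ∧ u k = v := by
  intro s t hst hstep hs ht
  induction t, hst using Nat.le_induction with
  | base => exact ⟨s, le_rfl, le_rfl, le_antisymm hs ht⟩
  | succ t hst ih =>
    by_cases h : v ≤ u t
    · obtain ⟨k, h1, h2, h3⟩ := ih (fun k hk hk' => hstep k hk (by omega)) h
      exact ⟨k, h1, by omega, h3⟩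
    · have := abs_le.1 (hstep t hst (by omega))
      exact ⟨t + 1, by omega, le_rfl, by omega⟩

lemma exists_eq_of_steps' {u : ℕ → ℤ} {v : ℤ} {s t : ℕ} (hst : s ≤ t)
    (hstep : ∀ k, s ≤ k → k < t → |u k - u (k + 1)| ≤ 1) (hs : v ≤ u s) (ht : u t ≤ v) :
    ∃ k, s ≤ k ∧ k ≤ t ∧ u k = v := by
  obtain ⟨k, h1, h2, h3⟩ := exists_eq_of_steps (u := fun k => -u k) (v := -v) hst
    (fun k hk hk' => by
      have := hstep k hk hk'
      rw [abs_le] at this ⊢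
      constructor <;> omega)
    (by omega) (by omega)
  exact ⟨k, h1, h2, by omega⟩

namespace Cell

variable {m : ℕ}

/-- The spider is a tree: a walk between two neighbours of `c` that avoids `c` is closed. -/
lemma eq_of_walk_avoiding {z : ℕ → Cell m} {c : Cell m} {s t : ℕ} (hst : s ≤ t)
    (hadj : ∀ k, s ≤ k → k < t → Adj (z k) (z (k + 1)))
    (hav : ∀ k, s ≤ k → k ≤ t → z k ≠ c) (hs : Adj c (z s)) (ht : Adj c (z t)) :
    z s = z t := by
  have hs' := hav s le_rfl hst
  have ht' := hav t hst le_rfl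
  have key : ∀ (r : Fin m) (k₀ : ℕ), c = mk r k₀ →
      ((k₀ : ℤ) < sgn r (z s) ↔ (k₀ : ℤ) < sgn r (z t)) := by
    intro r k₀ hc
    have hne : ∀ k, s ≤ k → k ≤ t → sgn r (z k) ≠ k₀ := fun k h1 h2 h3 =>
      hav k h1 h2 ((eq_mk_of_sgn h3).trans hc.symm)
    have hst1 : ∀ k, s ≤ k → k < t → |sgn r (z k) - sgn r (z (k + 1))| ≤ 1 :=
      fun k h1 h2 => (hadj k h1 h2).sgn_le r
    constructor
    · intro h
      by_contra h'
      obtain ⟨k, h1, h2, h3⟩ := exists_eq_of_steps' (u := fun k => sgn r (z k)) hst hst1 h.le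
        (not_lt.1 h')
      exact hne k h1 h2 h3
    · intro h
      by_contra h'
      obtain ⟨k, h1, h2, h3⟩ := exists_eq_of_steps (u := fun k => sgn r (z k)) hst hst1
        (not_lt.1 h') h.le
      exact hne k h1 h2 h3
  rcases c with _ | ⟨r, k₀⟩
  · have hform : ∀ c' : Cell m, Adj none c' → c' ≠ none → ∃ r, c' = mk r 1 := by
      rintro c' (h | ⟨r, k, ⟨h, rfl⟩ | ⟨h, rfl⟩⟩) hne
      · exact absurd h.symm hne
      · cases k with
        | zero => exact ⟨r, rfl⟩
        | succ k => simp [mk] at h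
      · simp [mk] at h
    obtain ⟨r, hr⟩ := hform _ hs hs'
    obtain ⟨r', hr'⟩ := hform _ ht ht'
    have := (key r 0 rfl).1 (by rw [hr]; simp)
    rw [hr'] at this
    by_cases hrr : r' = r
    · rw [hr, hr', hrr]
    · rw [sgn_mk_ne hrr] at this
      simp at this
  · have hk := key r (k₀ + 1) rfl
    rcases Adj.eq_of_ne (k := k₀) hs hs' with h1 | h1 <;>
      rcases Adj.eq_of_ne (k := k₀) ht ht' with h2 | h2 <;> rw [h1, h2] at hk ⊢ <;>
      simp at hk

end Cell

/-! ### Walks on a discrete spider with labels -/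

/-- The amplitude of the folding map on leg `j`, in the coordinate scaled by the number of
folds. -/
noncomputable def foldAmp (n j : ℕ) (p : ℝ) : ℝ := 1 - (j : ℝ) / (2 * n) * min 1 (2 * p)

/-- The radius of the value of the folding map. -/
noncomputable def foldVal (n j : ℕ) (p : ℝ) : ℝ :=
  foldAmp n j p * (1 - 2 * |p - (⌊p + 1 / 2⌋₊ : ℝ)|)

/-- A walk on a spider with `n` legs, recorded by the scaled radius `p` and the leg `j`, together
with a map `z` to the cells of a spider with `m` legs for which equal or neighbouring cells have
close labels. -/
structure LabelledWalk (n m L : ℕ) where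
  p : ℕ → ℝ
  j : ℕ → ℕ
  z : ℕ → Cell m
  three_le : 3 ≤ n
  p_nonneg : ∀ t, 0 ≤ p t
  j_lt : ∀ t, j t < n
  step : ∀ t < L, |p t - p (t + 1)| < 1 / (64 * n)
  leg : ∀ t < L, j t = j (t + 1) ∨ (p t < 1 / (64 * n) ∧ p (t + 1) < 1 / (64 * n))
  adj : ∀ t < L, Cell.Adj (z t) (z (t + 1))
  close : ∀ s ≤ L, ∀ t ≤ L, Cell.Adj (z s) (z t) →
    (⌊p s + 1 / 2⌋₊ % n = ⌊p t + 1 / 2⌋₊ % n ∧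
      |foldVal n (j s) (p s) - foldVal n (j t) (p t)| < 1 / (16 * n)) ∨
    (foldVal n (j s) (p s) < 1 / (16 * n) ∧ foldVal n (j t) (p t) < 1 / (16 * n))
  turn : ∀ s u t, s ≤ u → u ≤ t → t ≤ L → (∀ w, s ≤ w → w ≤ t → 1 / 4 < p w ∧ p w < n + 1) →
    min (p s) (p t) ≤ p u ∧ p u ≤ max (p s) (p t)

lemma foldAmp_le_one {n j : ℕ} {p : ℝ} (hp : 0 ≤ p) : foldAmp n j p ≤ 1 := by
  have : 0 ≤ (j : ℝ) / (2 * n) * min 1 (2 * p) := by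
    have : 0 ≤ min 1 (2 * p) := le_min one_pos.le (by linarith)
    positivity
  simp only [foldAmp]; linarith

lemma half_le_foldAmp {n j : ℕ} {p : ℝ} (hj : j < n) : 1 / 2 ≤ foldAmp n j p := by
  have hn : (0 : ℝ) < n := by exact_mod_cast (by omega : 0 < n)
  have h1 : (j : ℝ) / (2 * n) ≤ 1 / 2 := by
    rw [div_le_div_iff₀ (by positivity) (by norm_num)]
    have : (j : ℝ) ≤ n := by exact_mod_cast hj.le
    linarith
  have h2 : min 1 (2 * p) ≤ 1 := min_le_left _ _
  have h3 : (0 : ℝ) ≤ (j : ℝ) / (2 * n) := by positivity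
  simp only [foldAmp]; nlinarith

lemma abs_sub_floor_half {p : ℝ} (hp : 0 ≤ p) : |p - (⌊p + 1 / 2⌋₊ : ℝ)| ≤ 1 / 2 := by
  have h1 := Nat.floor_le (show 0 ≤ p + 1 / 2 by linarith)
  have h2 := Nat.lt_floor_add_one (p + 1 / 2)
  rw [abs_le]; constructor <;> linarith

lemma floor_half_eq {p : ℝ} (hp : 0 ≤ p) {k : ℕ} (h : |p - k| < 1 / 2) : ⌊p + 1 / 2⌋₊ = k := by
  rw [abs_lt] at h
  rw [Nat.floor_eq_iff (by linarith)]
  constructor <;> linarith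

/-- The number of naturals up to `q` congruent to `a < n` modulo `n`. -/
def countMod (n a q : ℕ) : ℕ := (q + n - a) / n

lemma countMod_succ {n a q : ℕ} (ha : a < n) (h : (q + 1) % n ≠ a) :
    countMod n a (q + 1) = countMod n a q := by
  unfold countMod
  have e : q + 1 + n - a = (q + n - a) + 1 := by omega
  rw [e, Nat.succ_div, if_neg, add_zero]
  intro hd
  apply h
  obtain ⟨k, hk⟩ := hd
  rcases k with _ | k
  · omega
  · have : q + 1 = a + n * k := by rw [Nat.mul_succ] at hk; omega
    rw [this, Nat.add_mul_mod_self_left, Nat.mod_eq_of_lt ha]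

lemma countMod_eq_zero {n a q : ℕ} (ha : a < n) : countMod n a q = 0 ↔ q < a := by
  unfold countMod
  rw [Nat.div_eq_zero_iff]
  omega

lemma eq_of_countMod {n a q q' : ℕ} (ha : a < n) (hm : q % n = q' % n)
    (h : countMod n a q = countMod n a q') : q = q' := by
  unfold countMod at h
  have e : (q + n - a) % n = (q' + n - a) % n := by
    have h1 : q + n - a = q + (n - a) := by omega
    have h2 : q' + n - a = q' + (n - a) := by omega
    rw [h1, h2, Nat.add_mod, hm, ← Nat.add_mod]
  have := Nat.div_add_mod (q + n - a) n
  have := Nat.div_add_mod (q' + n - a) n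
  rw [h, e] at *
  omega

lemma lt_of_countMod {n a q q' : ℕ} (ha : a < n) (h : countMod n a q = countMod n a q') :
    q < q' + n := by
  unfold countMod at h
  have h1 := Nat.div_add_mod (q + n - a) n
  have h2 := Nat.div_add_mod (q' + n - a) n
  have h3 := Nat.mod_lt (q + n - a) (show n > 0 by omega)
  rw [h] at h1
  omega

namespace LabelledWalk

variable {n m L : ℕ} (W : LabelledWalk n m L)

/-- The index of the fold. -/
noncomputable def K (t : ℕ) : ℕ := ⌊W.p t + 1 / 2⌋₊

/-- The radius of the label. -/
noncomputable def v (t : ℕ) : ℝ := foldVal n (W.j t) (W.p t)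

/-- Neighbouring times. -/
def Nb (s t : ℕ) : Prop :=
  |W.p s - W.p t| < 1 / (64 * n) ∧
    (W.j s = W.j t ∨ (W.p s < 1 / (64 * n) ∧ W.p t < 1 / (64 * n)))

variable {W}

lemma Nb.symm {s t : ℕ} (h : W.Nb s t) : W.Nb t s :=
  ⟨abs_sub_comm (W.p s) _ ▸ h.1, h.2.imp Eq.symm And.symm⟩

variable (W)

lemma nb_succ {t : ℕ} (ht : t < L) : W.Nb t (t + 1) := ⟨W.step t ht, W.leg t ht⟩

lemma eps_pos (W : LabelledWalk n m L) : (0 : ℝ) < 1 / (64 * n) := by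
  have : (0 : ℝ) < n := by exact_mod_cast (by have := W.three_le; omega : 0 < n)
  positivity

lemma eps_le (W : LabelledWalk n m L) : (1 : ℝ) / (64 * n) ≤ 1 / 192 := by
  have : (3 : ℝ) ≤ n := by exact_mod_cast W.three_le
  apply one_div_le_one_div_of_le <;> linarith

lemma eta_le (W : LabelledWalk n m L) : (1 : ℝ) / (16 * n) ≤ 1 / 48 := by
  have : (3 : ℝ) ≤ n := by exact_mod_cast W.three_le
  apply one_div_le_one_div_of_le <;> linarith

lemma abs_p_sub_K (t : ℕ) : |W.p t - W.K t| ≤ 1 / 2 := abs_sub_floor_half (W.p_nonneg t)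

lemma v_le (t : ℕ) : W.v t ≤ 1 - 2 * |W.p t - W.K t| := by
  have h1 := foldAmp_le_one (n := n) (j := W.j t) (W.p_nonneg t)
  have h2 := W.abs_p_sub_K t
  have h3 : W.v t = foldAmp n (W.j t) (W.p t) * (1 - 2 * |W.p t - W.K t|) := rfl
  rw [h3]; nlinarith

lemma le_v (t : ℕ) : 1 / 2 * (1 - 2 * |W.p t - W.K t|) ≤ W.v t := by
  have h1 := half_le_foldAmp (p := W.p t) (W.j_lt t)
  have h2 := W.abs_p_sub_K t
  have h3 : W.v t = foldAmp n (W.j t) (W.p t) * (1 - 2 * |W.p t - W.K t|) := rfl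
  rw [h3]; nlinarith

lemma v_eq {t : ℕ} (h : 1 / 2 ≤ W.p t) :
    W.v t = (1 - (W.j t : ℝ) / (2 * n)) * (1 - 2 * |W.p t - W.K t|) := by
  have h3 : W.v t = foldAmp n (W.j t) (W.p t) * (1 - 2 * |W.p t - W.K t|) := rfl
  rw [h3, foldAmp, min_eq_left (by linarith), mul_one]

lemma K_eq {t k : ℕ} (h : |W.p t - k| < 1 / 2) : W.K t = k := floor_half_eq (W.p_nonneg t) h

variable {W}

lemma K_eq_of_nb {s t : ℕ} (h : W.Nb s t) (hv : 1 / 10 ≤ W.v s) : W.K t = W.K s := by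
  apply W.K_eq
  have h1 := W.v_le s
  have h2 := h.1
  have h3 := W.eps_le
  have h4 := abs_sub_le (W.p t) (W.p s) (W.K s)
  rw [abs_sub_comm (W.p t) (W.p s)] at h4
  linarith

lemma le_v_of_near {t k : ℕ} (h : |W.p t - k| < 1 / (64 * n)) : W.K t = k ∧ 2 / 5 ≤ W.v t := by
  have h3 := W.eps_le
  have hk : W.K t = k := W.K_eq (by linarith)
  refine ⟨hk, ?_⟩
  have := W.le_v t
  rw [hk] at this
  linarith

lemma near_of_floor_lt {s t : ℕ} (h : W.Nb s t) (hlt : ⌊W.p s⌋₊ < ⌊W.p t⌋₊) :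
    ⌊W.p t⌋₊ = ⌊W.p s⌋₊ + 1 ∧ |W.p s - ⌊W.p t⌋₊| < 1 / (64 * n) ∧
      |W.p t - ⌊W.p t⌋₊| < 1 / (64 * n) := by
  have h1 := Nat.lt_floor_add_one (W.p s)
  have h2 := Nat.floor_le (W.p_nonneg t)
  have h4 := abs_lt.1 h.1
  have h5 := W.eps_le
  have e : ⌊W.p t⌋₊ = ⌊W.p s⌋₊ + 1 := by
    apply le_antisymm _ hlt
    by_contra h'
    have h7 : ⌊W.p s⌋₊ + 1 + 1 ≤ ⌊W.p t⌋₊ := by omega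
    have h7 : ((⌊W.p s⌋₊ + 1 + 1 : ℕ) : ℝ) ≤ ⌊W.p t⌋₊ := by exact_mod_cast h7
    push_cast at h7
    linarith
  have h7 : ((⌊W.p s⌋₊ + 1 : ℕ) : ℝ) = ⌊W.p t⌋₊ := by exact_mod_cast e.symm
  push_cast at h7
  refine ⟨e, ?_, ?_⟩ <;> rw [abs_lt] <;> constructor <;> linarith

lemma floor_leg_of_v_lt {s t : ℕ} (h : W.Nb s t) (hv : W.v s < 2 / 5) :
    ⌊W.p s⌋₊ = ⌊W.p t⌋₊ ∧ W.j s = W.j t := by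
  constructor
  · rcases lt_trichotomy ⌊W.p s⌋₊ ⌊W.p t⌋₊ with h' | h' | h'
    · have := (le_v_of_near (near_of_floor_lt h h').2.1).2
      linarith
    · exact h'
    · have := (le_v_of_near (near_of_floor_lt h.symm h').2.2).2
      linarith
  · rcases h.2 with h' | h'
    · exact h'
    · have := (le_v_of_near (t := s) (k := 0) (W := W)
        (by simpa [abs_of_nonneg (W.p_nonneg s)] using h'.1)).2
      linarith

variable (W)

lemma floor_eq_K_or (t : ℕ) : ⌊W.p t⌋₊ = W.K t ∨ (W.K t = ⌊W.p t⌋₊ + 1) := by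
  have h1 : ⌊W.p t⌋₊ ≤ W.K t := Nat.floor_le_floor (by linarith)
  have h2 : W.K t ≤ ⌊W.p t⌋₊ + 1 := by
    have : ⌊W.p t + 1⌋₊ = ⌊W.p t⌋₊ + 1 := by
      exact Nat.floor_add_one (W.p_nonneg t)
    rw [← this]
    exact Nat.floor_le_floor (by linarith)
  omega

lemma countMod_floor {a t : ℕ} (ha : a < n) (h : W.K t % n ≠ a) :
    countMod n a ⌊W.p t⌋₊ = countMod n a (W.K t) := by
  rcases W.floor_eq_K_or t with h' | h'
  · rw [h']
  · rw [h'] at h ⊢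
    exact (countMod_succ ha h).symm

/-- The same number of crossings of folds of direction `a`. -/
def R (a s t : ℕ) : Prop :=
  countMod n a ⌊W.p s⌋₊ = countMod n a ⌊W.p t⌋₊ ∧
    (countMod n a ⌊W.p s⌋₊ = 0 ∨ W.j s = W.j t)

/-- The same fold. -/
def Y (s t : ℕ) : Prop := W.K s = W.K t ∧ (W.j s = W.j t ∨ W.K s < n)

variable {W}

lemma R.symm {a s t : ℕ} (h : W.R a s t) : W.R a t s :=
  ⟨h.1.symm, by rw [← h.1]; exact h.2.imp id Eq.symm⟩

lemma R.trans {a s t u : ℕ} (h : W.R a s t) (h' : W.R a t u) : W.R a s u := by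
  obtain ⟨h1, h2⟩ := h
  obtain ⟨h3, h4⟩ := h'
  refine ⟨h1.trans h3, ?_⟩
  rcases h2 with h2 | h2
  · exact Or.inl h2
  · rcases h4 with h4 | h4
    · exact Or.inl (h1.trans h4)
    · exact Or.inr (h2.trans h4)

lemma Y.symm {s t : ℕ} (h : W.Y s t) : W.Y t s := ⟨h.1.symm, h.1 ▸ h.2.imp Eq.symm id⟩

lemma Y.trans {s t u : ℕ} (h : W.Y s t) (h' : W.Y t u) : W.Y s u := by
  obtain ⟨h1, h2⟩ := h
  obtain ⟨h3, h4⟩ := h'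
  refine ⟨h1.trans h3, ?_⟩
  rcases h2 with h2 | h2
  · rcases h4 with h4 | h4
    · exact Or.inl (h2.trans h4)
    · exact Or.inr (by omega)
  · exact Or.inr h2

lemma K_eq_zero_of_leg {s t : ℕ} (h : W.Nb s t) (hj : W.j s ≠ W.j t) :
    W.K s = 0 ∧ W.K t = 0 := by
  obtain h' := h.2.resolve_left hj
  constructor
  · exact (le_v_of_near (t := s) (k := 0) (W := W)
        (by simpa [abs_of_nonneg (W.p_nonneg s)] using h'.1)).1
  · exact (le_v_of_near (t := t) (k := 0) (W := W)
        (by simpa [abs_of_nonneg (W.p_nonneg t)] using h'.2)).1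

lemma Y_of_nb {s t : ℕ} (h : W.Nb s t) (hv : 1 / 10 ≤ W.v s) : W.Y s t := by
  refine ⟨(K_eq_of_nb h hv).symm, ?_⟩
  by_cases hj : W.j s = W.j t
  · exact Or.inl hj
  · exact Or.inr (by rw [(K_eq_zero_of_leg h hj).1]; have := W.three_le; omega)

lemma R_of_nb_K {a s t : ℕ} (ha : a < n) (h : W.Nb s t) (hK : W.K t = W.K s)
    (ha' : W.K s % n ≠ a) : W.R a s t := by
  have e1 := W.countMod_floor ha ha'
  have e2 := W.countMod_floor ha (hK ▸ ha')
  refine ⟨by rw [e1, e2, hK], ?_⟩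
  by_cases hj : W.j s = W.j t
  · exact Or.inr hj
  · left
    rw [e1, (K_eq_zero_of_leg h hj).1, countMod_eq_zero ha]
    rw [(K_eq_zero_of_leg h hj).1, Nat.zero_mod] at ha'
    omega

/-- A step at which no fold of direction `a` is crossed. -/
lemma R_of_nb {a s t : ℕ} (ha : a < n) (h : W.Nb s t) (h' : W.K s % n ≠ a ∨ W.v s < 2 / 5) :
    W.R a s t := by
  by_cases hv : W.v s < 2 / 5
  · have := floor_leg_of_v_lt h hv
    exact ⟨by rw [this.1], Or.inr this.2⟩
  · exact R_of_nb_K ha h (K_eq_of_nb h (by linarith)) (h'.resolve_right hv)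

end LabelledWalk

namespace LabelledWalk

variable {n m L : ℕ} (W : LabelledWalk n m L)

/-- The reversed walk. -/
noncomputable def rev : LabelledWalk n m L where
  p t := W.p (L - t)
  j t := W.j (L - t)
  z t := W.z (L - t)
  three_le := W.three_le
  p_nonneg _ := W.p_nonneg _
  j_lt _ := W.j_lt _
  step t ht := by
    have := W.step (L - (t + 1)) (by omega)
    rw [show L - (t + 1) + 1 = L - t by omega, abs_sub_comm] at this
    exact this
  leg t ht := by
    have := W.leg (L - (t + 1)) (by omega)
    rw [show L - (t + 1) + 1 = L - t by omega] at this
    exact this.imp Eq.symm And.symm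
  adj t ht := by
    have := W.adj (L - (t + 1)) (by omega)
    rw [show L - (t + 1) + 1 = L - t by omega] at this
    exact this.symm
  close s _ t _ h := W.close _ (by omega) _ (by omega) h
  turn s u t hsu hut ht h := by
    have := W.turn (L - t) (L - u) (L - s) (by omega) (by omega) (by omega) (fun w h1 h2 => by
      have := h (L - w) (by omega) (by omega)
      rwa [show L - (L - w) = w by omega] at this)
    rwa [min_comm, max_comm]

/-- Cells over which the label is away from the centre. -/
def lo (c : Cell m) : Prop := ∃ t ≤ L, W.z t = c ∧ 1 / 8 ≤ W.v t

/-- Cells over which the label is far away from the centre. -/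
def hi (c : Cell m) : Prop := ∃ t ≤ L, W.z t = c ∧ 1 / 4 ≤ W.v t

variable {W}

lemma exists_rev {P : ℕ → Prop} (h : ∃ t ≤ L, P (L - t)) : ∃ t ≤ L, P t :=
  h.elim fun t ht => ⟨L - t, by omega, ht.2⟩

lemma exists_of_rev {P : ℕ → Prop} (h : ∃ t ≤ L, P t) : ∃ t ≤ L, P (L - t) :=
  h.elim fun t ht => ⟨L - t, by omega, by rw [show L - (L - t) = t by omega]; exact ht.2⟩

lemma rev_lo {c : Cell m} : W.rev.lo c ↔ W.lo c :=
  ⟨fun h => exists_rev (P := fun t => W.z t = c ∧ 1 / 8 ≤ W.v t) h, fun h => exists_of_rev h⟩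

lemma rev_hi {c : Cell m} : W.rev.hi c ↔ W.hi c :=
  ⟨fun h => exists_rev (P := fun t => W.z t = c ∧ 1 / 4 ≤ W.v t) h, fun h => exists_of_rev h⟩

lemma rev_K (t : ℕ) : W.rev.K t = W.K (L - t) := rfl
lemma rev_v (t : ℕ) : W.rev.v t = W.v (L - t) := rfl
lemma rev_z (t : ℕ) : W.rev.z t = W.z (L - t) := rfl
lemma rev_j (t : ℕ) : W.rev.j t = W.j (L - t) := rfl

lemma close_of_lo {c : Cell m} (h : W.lo c) {t : ℕ} (ht : t ≤ L) (ha : Cell.Adj c (W.z t)) :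
    ∃ s ≤ L, W.z s = c ∧ W.K t % n = W.K s % n ∧ 1 / 8 ≤ W.v s ∧
      |W.v s - W.v t| < 1 / (16 * n) := by
  obtain ⟨s, hs, rfl, hv⟩ := h
  rcases W.close s hs t ht ha with h' | h'
  · exact ⟨s, hs, rfl, h'.1.symm, hv, h'.2⟩
  · have h1 := W.eta_le
    have : W.v s < 1 / (16 * n) := h'.1
    linarith

lemma v_of_lo {c : Cell m} (h : W.lo c) {t : ℕ} (ht : t ≤ L) (ha : Cell.Adj c (W.z t)) :
    1 / 10 ≤ W.v t := by
  obtain ⟨s, hs, -, -, h1, h2⟩ := close_of_lo h ht ha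
  have := abs_lt.1 h2
  have := W.eta_le
  linarith

lemma v_lt_of_not_lo {t : ℕ} (ht : t ≤ L) (h : ¬ W.lo (W.z t)) : W.v t < 1 / 8 := by
  by_contra h'
  exact h ⟨t, ht, rfl, not_lt.1 h'⟩

variable (W) in
open Classical in
/-- The direction of the label over a cell. -/
noncomputable def dir (c : Cell m) : ℕ := if h : W.lo c then W.K h.choose % n else 0

lemma dir_eq {c : Cell m} (h : W.lo c) {t : ℕ} (ht : t ≤ L) (ha : Cell.Adj c (W.z t)) :
    W.K t % n = W.dir c := by
  have hc := h.choose_spec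
  rw [dir, dif_pos h]
  have hs : W.z h.choose = c := hc.2.1
  rcases W.close h.choose hc.1 t ht (by rw [hs]; exact ha) with h' | h'
  · exact h'.1.symm
  · have h1 := W.eta_le
    have h2 : W.v h.choose < 1 / (16 * n) := h'.1
    have := hc.2.2
    linarith

lemma dir_eq_of_adj {c c' : Cell m} (h : W.lo c) (h' : W.lo c') (ha : Cell.Adj c c') :
    W.dir c' = W.dir c := by
  obtain ⟨t, ht, rfl, -⟩ := id h'
  rw [← dir_eq h ht ha, ← dir_eq h' ht (Cell.Adj.refl _)]

variable (W)

/-- All cells between two cells on a leg are over labels away from the centre. -/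
def Seg (r : Fin m) (k x : ℕ) : Prop := ∀ y, min k x ≤ y → y ≤ max k x → W.lo (Cell.mk r y)

/-- Cells in an interval of labels away from the centre that does not reach the centre. -/
def Far (r : Fin m) (k : ℕ) : Prop :=
  ∃ k₁, W.hi (Cell.mk r k₁) ∧ W.Seg r k k₁ ∧ ∃ k₀ < k, ¬ W.lo (Cell.mk r k₀)

variable {W}

lemma rev_Seg {r : Fin m} {k x : ℕ} : W.rev.Seg r k x ↔ W.Seg r k x := by
  simp only [Seg, rev_lo]

lemma rev_Far {r : Fin m} {k : ℕ} : W.rev.Far r k ↔ W.Far r k := by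
  simp only [Far, rev_Seg, rev_lo, rev_hi]

lemma Far.lo {r : Fin m} {k : ℕ} (h : W.Far r k) : W.lo (Cell.mk r k) := by
  obtain ⟨k₁, -, h, -⟩ := h
  exact h k (min_le_left _ _) (le_max_left _ _)

lemma Far.pos {r : Fin m} {k : ℕ} (h : W.Far r k) : 0 < k := by
  obtain ⟨k₁, -, -, k₀, h, -⟩ := h
  omega

lemma Far.of_succ {r : Fin m} {k : ℕ} (h : W.Far r (k + 1)) (hl : W.lo (Cell.mk r k)) :
    W.Far r k := by
  obtain ⟨k₁, h1, h2, k₀, h3, h4⟩ := h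
  refine ⟨k₁, h1, fun y hy hy' => ?_, k₀, ?_, h4⟩
  · by_cases hk : y = k
    · exact hk ▸ hl
    · exact h2 y (by omega) (by omega)
  · by_contra h'
    obtain rfl : k₀ = k := by omega
    exact h4 hl

lemma Far.succ {r : Fin m} {k : ℕ} (h : W.Far r k) (hl : W.lo (Cell.mk r (k + 1))) :
    W.Far r (k + 1) := by
  obtain ⟨k₁, h1, h2, k₀, h3, h4⟩ := h
  refine ⟨k₁, h1, fun y hy hy' => ?_, k₀, by omega, h4⟩
  by_cases hk : y = k + 1
  · exact hk ▸ hl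
  · exact h2 y (by omega) (by omega)

lemma abs_sgn_le (r : Fin m) {t : ℕ} (ht : t < L) :
    |Cell.sgn r (W.z t) - Cell.sgn r (W.z (t + 1))| ≤ 1 := (W.adj t ht).sgn_le r

/-- A walk that enters a far interval and later changes legs traverses the interval. -/
lemma exists_traverse {s e k : ℕ} {r : Fin m} (he : e ≤ L) (hse : s < e)
    (hz : W.z (s + 1) = Cell.mk r k) (hF : W.Far r k) (hc : ¬ W.lo (W.z s))
    (hav : ∀ u, s < u → u ≤ e → W.z u ≠ W.z s) (hK : 1 ≤ W.K (s + 1))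
    (hj : W.j e ≠ W.j (s + 1)) :
    ∃ e₁, s + 1 < e₁ ∧ e₁ ≤ e ∧ ¬ W.lo (W.z e₁) ∧
      (∀ u, s < u → u < e₁ → W.K u = W.K (s + 1) ∧ W.j u = W.j (s + 1) ∧
        ∃ x, W.z u = Cell.mk r x ∧ W.Seg r k x) ∧
      ∀ x, W.Seg r k x → ∃ u, s < u ∧ u < e₁ ∧ W.z u = Cell.mk r x := by
  have hlo := hF.lo
  have hconst : ∀ u, s + 1 ≤ u → u ≤ e → (∀ w, s < w → w < u → W.lo (W.z w)) →
      W.K u = W.K (s + 1) ∧ W.j u = W.j (s + 1) := by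
    intro u hu
    induction u, hu using Nat.le_induction with
    | base => exact fun _ _ => ⟨rfl, rfl⟩
    | succ u hu ih =>
      intro hue hall
      obtain ⟨h1, h2⟩ := ih (by omega) fun w hw hw' => hall w hw (by omega)
      have hv := v_of_lo (hall u (by omega) (by omega)) (by omega) (Cell.Adj.refl _)
      have hnb := W.nb_succ (t := u) (by omega)
      refine ⟨(K_eq_of_nb hnb hv).trans h1, ?_⟩
      rw [← h2]
      by_contra hne
      have := (K_eq_zero_of_leg hnb (Ne.symm hne)).1
      omega
  have hex : ∃ u, s + 1 ≤ u ∧ u ≤ e ∧ ¬ W.lo (W.z u) := by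
    by_contra! hne
    exact hj (hconst e (by omega) le_rfl fun w hw hw' => hne w hw (by omega)).2
  classical
  let e₁ := Nat.find hex
  obtain ⟨h1, h2, h3⟩ : s + 1 ≤ e₁ ∧ e₁ ≤ e ∧ ¬ W.lo (W.z e₁) := Nat.find_spec hex
  have hmin : ∀ u, s < u → u < e₁ → W.lo (W.z u) := by
    intro u hu hu'
    by_contra hl
    exact Nat.find_min hex hu' ⟨hu, by omega, hl⟩
  have h1' : s + 1 < e₁ := by
    rcases h1.lt_or_eq with h | h
    · exact h
    · rw [← h, hz] at h3
      exact absurd hlo h3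
  obtain ⟨k₁, hk1, hk2, k₀, hk3, hk4⟩ := id hF
  have hstep : ∀ a b, s + 1 ≤ a → b ≤ e₁ → ∀ u, a ≤ u → u < b →
      |Cell.sgn r (W.z u) - Cell.sgn r (W.z (u + 1))| ≤ 1 :=
    fun a b _ hb u _ hu' => abs_sgn_le r (by omega)
  have hsz : Cell.sgn r (W.z (s + 1)) = k := by rw [hz]; simp
  have hpos : ∀ u, s < u → u < e₁ → (k₀ : ℤ) < Cell.sgn r (W.z u) := by
    intro u hu hu'
    by_contra hle
    obtain ⟨w, hw1, hw2, hw3⟩ := exists_eq_of_steps' (u := fun u => Cell.sgn r (W.z u))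
      (v := k₀) (show s + 1 ≤ u by omega) (hstep _ _ le_rfl hu'.le)
      (by simp only [hsz]; omega) (by omega)
    have := hmin w (by omega) (by omega)
    rw [Cell.eq_mk_of_sgn hw3] at this
    exact hk4 this
  have hpose : (k₀ : ℤ) ≤ Cell.sgn r (W.z e₁) := by
    have h := hpos (e₁ - 1) (by omega) (by omega)
    have h' := abs_le.1 (abs_sgn_le (W := W) r (t := e₁ - 1) (by omega))
    rw [show e₁ - 1 + 1 = e₁ by omega] at h'
    omega
  obtain ⟨y, hy⟩ : ∃ y : ℕ, Cell.sgn r (W.z e₁) = y := ⟨(Cell.sgn r (W.z e₁)).toNat, by omega⟩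
  have hze := Cell.eq_mk_of_sgn hy
  have hvis : ∀ x : ℕ, min (k : ℤ) y ≤ x → (x : ℤ) ≤ max (k : ℤ) y →
      ∃ u, s < u ∧ u ≤ e₁ ∧ W.z u = Cell.mk r x := by
    intro x hx hx'
    rcases le_total k y with h | h
    · obtain ⟨w, hw1, hw2, hw3⟩ := exists_eq_of_steps (u := fun u => Cell.sgn r (W.z u))
        (v := x) h1 (hstep _ _ le_rfl le_rfl) (by simp only [hsz]; omega)
        (by simp only [hy]; omega)
      exact ⟨w, by omega, hw2, Cell.eq_mk_of_sgn hw3⟩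
    · obtain ⟨w, hw1, hw2, hw3⟩ := exists_eq_of_steps' (u := fun u => Cell.sgn r (W.z u))
        (v := x) h1 (hstep _ _ le_rfl le_rfl) (by simp only [hsz]; omega)
        (by simp only [hy]; omega)
      exact ⟨w, by omega, hw2, Cell.eq_mk_of_sgn hw3⟩
  refine ⟨e₁, h1', h2, h3, fun u hu hu' => ?_, fun x hx => ?_⟩
  · obtain ⟨h4, h5⟩ := hconst u hu (by omega) fun w hw hw' => hmin w hw (by omega)
    refine ⟨h4, h5, ?_⟩
    have hp := hpos u hu hu'
    obtain ⟨x, hx⟩ : ∃ x : ℕ, Cell.sgn r (W.z u) = x := ⟨(Cell.sgn r (W.z u)).toNat, by omega⟩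
    refine ⟨x, Cell.eq_mk_of_sgn hx, fun w hw hw' => ?_⟩
    obtain ⟨q, hq1, hq2, hq3⟩ : ∃ q, s + 1 ≤ q ∧ q ≤ u ∧ Cell.sgn r (W.z q) = w := by
      rcases le_total k x with h | h
      · exact exists_eq_of_steps (u := fun u => Cell.sgn r (W.z u))
          (v := w) hu (hstep _ _ le_rfl hu'.le) (by simp only [hsz]; omega)
          (by simp only [hx]; omega)
      · exact exists_eq_of_steps' (u := fun u => Cell.sgn r (W.z u))
          (v := w) hu (hstep _ _ le_rfl hu'.le) (by simp only [hsz]; omega)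
          (by simp only [hx]; omega)
    have := hmin q (by omega) (by omega)
    rwa [Cell.eq_mk_of_sgn hq3] at this
  · have hxlo := hx x (min_le_right _ _) (le_max_right _ _)
    have hyx : ¬ W.lo (Cell.mk r y) := hze ▸ h3
    suffices h : min k y ≤ x ∧ x ≤ max k y by
      obtain ⟨u, hu1, hu2, hu3⟩ := hvis x (by omega) (by omega)
      refine ⟨u, hu1, lt_of_le_of_ne hu2 ?_, hu3⟩
      rintro rfl
      rw [hu3] at h3
      exact h3 hxlo
    have hyn : ¬ (min k x ≤ y ∧ y ≤ max k x) := fun h => hyx (hx y h.1 h.2)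
    by_contra hxn
    obtain ⟨k', rfl⟩ : ∃ k', k = k' + 1 := ⟨k - 1, by have := hF.pos; omega⟩
    have hs' : W.z s = Cell.mk r k' ∨ W.z s = Cell.mk r (k' + 2) := by
      apply Cell.Adj.eq_of_ne
      · rw [← hz]; exact (W.adj s (by omega)).symm
      · intro h; rw [h] at hc; exact hc hlo
    obtain ⟨c, hcz, hc'⟩ : ∃ c, W.z s = Cell.mk r c ∧ (c = k' ∨ c = k' + 2) := by
      rcases hs' with h | h
      · exact ⟨_, h, Or.inl rfl⟩
      · exact ⟨_, h, Or.inr rfl⟩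
    have hcx : ¬ (min (k' + 1) x ≤ c ∧ c ≤ max (k' + 1) x) := fun h =>
      hc (hcz ▸ hx c h.1 h.2)
    have hcy : ¬ (min (k' + 1) y ≤ c ∧ c ≤ max (k' + 1) y) := fun h => by
      obtain ⟨u, hu1, hu2, hu3⟩ := hvis c (by omega) (by omega)
      exact hav u hu1 (by omega) (hu3.trans hcz.symm)
    omega

/-- A walk that enters a far interval over a fold of small index and later changes legs passes
over the tip of the fold. -/
lemma exists_traverse_top {s e k : ℕ} {r : Fin m} (he : e ≤ L) (hse : s < e)
    (hz : W.z (s + 1) = Cell.mk r k) (hF : W.Far r k) (hc : ¬ W.lo (W.z s))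
    (hav : ∀ u, s < u → u ≤ e → W.z u ≠ W.z s) (hK : 1 ≤ W.K (s + 1)) (hKn : W.K (s + 1) < n)
    (hj : W.j e ≠ W.j (s + 1)) :
    (∀ x, W.Seg r k x → ∃ u ≤ L, W.z u = Cell.mk r x ∧
      W.v u ≤ 1 - (W.j (s + 1) : ℝ) / (2 * n)) ∧
    ∃ x, W.Seg r k x ∧ ∃ u ≤ L, W.z u = Cell.mk r x ∧
      1 - (W.j (s + 1) : ℝ) / (2 * n) - 2 * (1 / (64 * n)) ≤ W.v u := by
  obtain ⟨e₁, h1, h2, h3, h4, h5⟩ := exists_traverse he hse hz hF hc hav hK hj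
  have heps := W.eps_le
  have heps0 := W.eps_pos
  have heta := W.eta_le
  set J := W.j (s + 1) with hJ
  set K₀ := W.K (s + 1) with hK₀
  have hK1 : (1 : ℝ) ≤ K₀ := by exact_mod_cast hK
  have hKn1 : (K₀ : ℝ) + 1 ≤ n := by exact_mod_cast hKn
  have hJn : J < n := W.j_lt _
  have hn0 : (0 : ℝ) < n := by linarith
  have hd1 : (J : ℝ) / (2 * n) < 1 / 2 := by
    rw [div_lt_div_iff₀ (by positivity) (by norm_num)]
    have : (J : ℝ) < n := by exact_mod_cast hJn
    linarith
  have hd0 : (0 : ℝ) ≤ (J : ℝ) / (2 * n) := by positivity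
  set d : ℝ := 1 - (J : ℝ) / (2 * n) with hd
  have hbd : ∀ u, W.K u = K₀ → 1 / 2 ≤ W.p u ∧ W.p u ≤ K₀ + 1 / 2 := by
    intro u hu
    have := abs_le.1 (W.abs_p_sub_K u)
    rw [hu] at this
    constructor <;> linarith
  have hval : ∀ u, W.K u = K₀ → W.j u = J → W.v u = d * (1 - 2 * |W.p u - K₀|) := by
    intro u hu hu'
    rw [W.v_eq (hbd u hu).1, hu, hu']
  have hvle : ∀ u, W.K u = K₀ → W.j u = J → W.v u ≤ d := by
    intro u hu hu'
    rw [hval u hu hu']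
    have := abs_nonneg (W.p u - K₀)
    nlinarith
  refine ⟨fun x hx => ?_, ?_⟩
  · obtain ⟨u, hu1, hu2, hu3⟩ := h5 x hx
    exact ⟨u, by omega, hu3, hvle u (h4 u hu1 hu2).1 (h4 u hu1 hu2).2.1⟩
  suffices h : ∃ u, s < u ∧ u < e₁ ∧ |W.p u - K₀| < 1 / (64 * n) by
    obtain ⟨u, hu1, hu2, hu3⟩ := h
    obtain ⟨h6, h7, x, h8, h9⟩ := h4 u hu1 hu2
    refine ⟨x, h9, u, by omega, h8, ?_⟩
    rw [hval u h6 h7]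
    nlinarith
  by_contra! hno
  have hnbs : W.Nb s (s + 1) := W.nb_succ (by omega)
  have hnbe : W.Nb (e₁ - 1) e₁ := by
    have := W.nb_succ (t := e₁ - 1) (by omega)
    rwa [show e₁ - 1 + 1 = e₁ by omega] at this
  have hv1 : ∀ u, s < u → u < e₁ → 1 / 10 ≤ W.v u := by
    intro u hu hu'
    obtain ⟨-, -, x, h8, h9⟩ := h4 u hu hu'
    exact v_of_lo (h9 x (min_le_right _ _) (le_max_right _ _)) (by omega)
      (h8 ▸ Cell.Adj.refl _)
  have hend : ∀ u u', s < u → u < e₁ → W.Nb u u' → W.K u' = K₀ ∧ W.j u' = J := by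
    intro u u' hu hu' hnb
    obtain ⟨h6, h7, -⟩ := h4 u hu hu'
    have h8 := K_eq_of_nb hnb (hv1 u hu hu')
    refine ⟨h8.trans h6, ?_⟩
    rw [← h7]
    by_contra hne
    have := (K_eq_zero_of_leg hnb (Ne.symm hne)).1
    omega
  obtain ⟨hsK, hsJ⟩ := hend (s + 1) s (by omega) h1 hnbs.symm
  obtain ⟨heK, heJ⟩ := hend (e₁ - 1) e₁ (by omega) (by omega) hnbe
  have hvs := v_lt_of_not_lo (by omega) hc
  have hve := v_lt_of_not_lo (by omega) h3
  have hall : ∀ u, s ≤ u → u ≤ e₁ → W.K u = K₀ ∧ W.j u = J := by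
    intro u hu hu'
    rcases hu.eq_or_lt with rfl | hu
    · exact ⟨hsK, hsJ⟩
    rcases hu'.eq_or_lt with rfl | hu'
    · exact ⟨heK, heJ⟩
    · exact ⟨(h4 u hu hu').1, (h4 u hu hu').2.1⟩
  obtain ⟨k₁, hk1, hk2, -⟩ := id hF
  obtain ⟨um, hm1, hm2, hm3⟩ := h5 k₁ hk2
  have hvm : 1 / 5 < W.v um := by
    obtain ⟨q, hq, hq1, hq2⟩ := hk1
    rcases W.close q hq um (by omega) (by rw [hq1, hm3]; exact Cell.Adj.refl _) with h | h
    · have h : |W.v q - W.v um| < 1 / (16 * n) := h.2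
      have := abs_lt.1 h
      linarith
    · have h : W.v q < 1 / (16 * n) := h.1
      linarith
  have hturn := W.turn s um e₁ (by omega) (by omega) (by omega) (fun w hw hw' => by
    obtain ⟨h6, h7⟩ := hbd w (hall w hw hw').1
    constructor <;> linarith)
  have hvs' := hval s hsK hsJ
  have hve' := hval e₁ heK heJ
  have hvm' := hval um (hall um (by omega) (by omega)).1 (hall um (by omega) (by omega)).2
  rw [hvs'] at hvs
  rw [hve'] at hve
  rw [hvm'] at hvm
  have hside : (∀ u, s + 1 ≤ u → u < e₁ → W.p u < K₀) ∨ (∀ u, s + 1 ≤ u → u < e₁ → K₀ < W.p u) := by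
    have hind : ∀ u, s + 1 ≤ u → u + 1 < e₁ → (W.p u < K₀ ↔ W.p (u + 1) < K₀) := by
      intro u hu hu'
      have a1 := hno u (by omega) (by omega)
      have a2 := hno (u + 1) (by omega) (by omega)
      have a3 := abs_lt.1 (W.step u (by omega))
      constructor
      · intro h
        rw [abs_of_neg (by linarith)] at a1
        linarith
      · intro h
        rw [abs_of_neg (by linarith)] at a2
        linarith
    have hne : ∀ u, s + 1 ≤ u → u < e₁ → W.p u ≠ K₀ := by
      intro u hu hu' h
      have := hno u (by omega) hu'
      rw [h, sub_self, abs_zero] at this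
      linarith
    have hiff : ∀ u, s + 1 ≤ u → u < e₁ → (W.p (s + 1) < K₀ ↔ W.p u < K₀) := by
      intro u hu
      induction u, hu using Nat.le_induction with
      | base => exact fun _ => Iff.rfl
      | succ u hu ih => exact fun h => (ih (by omega)).trans (hind u hu h)
    rcases lt_or_ge (W.p (s + 1)) K₀ with h | h
    · exact Or.inl fun u hu hu' => (hiff u hu hu').1 h
    · refine Or.inr fun u hu hu' => ?_
      rcases (hne u hu hu').lt_or_gt with h' | h'
      · exact absurd ((hiff u hu hu').2 h') (not_lt.2 h)
      · exact h'
  have hms : |W.p um - K₀| < |W.p s - K₀| := by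
    by_contra! h'
    nlinarith
  have hme : |W.p um - K₀| < |W.p e₁ - K₀| := by
    by_contra! h'
    nlinarith
  have a1 := hno (s + 1) (by omega) h1
  have a2 := hno (e₁ - 1) (by omega) (by omega)
  have a3 := abs_lt.1 hnbs.1
  have a4 := abs_lt.1 hnbe.1
  rcases hside with h | h
  · have b1 := h (s + 1) le_rfl h1
    have b2 := h (e₁ - 1) (by omega) (by omega)
    have b3 := h um (by omega) hm2
    rw [abs_of_neg (by linarith)] at a1 a2 hms hme
    rw [abs_of_neg (by linarith)] at hms hme
    have := max_lt (show W.p s < W.p um by linarith) (show W.p e₁ < W.p um by linarith)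
    linarith
  · have b1 := h (s + 1) le_rfl h1
    have b2 := h (e₁ - 1) (by omega) (by omega)
    have b3 := h um (by omega) hm2
    rw [abs_of_pos (by linarith)] at a1 a2 hms hme
    rw [abs_of_pos (by linarith)] at hms hme
    have := lt_min (show W.p um < W.p s by linarith) (show W.p um < W.p e₁ by linarith)
    linarith

/-- A loop entering and leaving a far interval through its end stays on the same leg if the fold
has small index. -/
lemma leg_eq_of_loop {s t k : ℕ} {r : Fin m} (ht : t ≤ L) (hst : s + 1 < t)
    (hz : W.z (s + 1) = Cell.mk r k) (hz' : W.z (t - 1) = Cell.mk r k) (hzs : W.z s = W.z t)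
    (hF : W.Far r k) (hc : ¬ W.lo (W.z s))
    (hav : ∀ u, s < u → u < t → W.z u ≠ W.z s)
    (hK : 1 ≤ W.K (s + 1)) (hKn : W.K (s + 1) < n) (hKK : W.K (s + 1) = W.K (t - 1)) :
    W.j (s + 1) = W.j (t - 1) := by
  by_contra hj
  obtain ⟨a1, x1, a2, u1, a3, a4, a5⟩ := exists_traverse_top (e := t - 1) (by omega) (by omega) hz
    hF hc (fun u hu hu' => hav u hu (by omega)) hK hKn (Ne.symm hj)
  have e1 : L - (L - t + 1) = t - 1 := by omega
  have e2 : L - (L - t) = t := by omega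
  have e3 : L - (L - (s + 1)) = s + 1 := by omega
  obtain ⟨b1, x2, b2, u2, b3, b4, b5⟩ := exists_traverse_top (W := W.rev) (s := L - t)
    (e := L - (s + 1)) (k := k) (r := r) (by omega) (by omega)
    (by rw [rev_z, e1, hz']) (rev_Far.2 hF) (by rw [rev_z, rev_lo, e2, ← hzs]; exact hc)
    (fun u hu hu' => by
      rw [rev_z, rev_z, e2, ← hzs]
      exact hav _ (by omega) (by omega))
    (by rw [rev_K, e1, ← hKK]; exact hK) (by rw [rev_K, e1, ← hKK]; exact hKn)
    (by rw [rev_j, rev_j, e1, e3]; exact hj)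
  rw [rev_j, e1] at b1 b5
  rw [rev_z] at b4
  rw [rev_v] at b5
  have hn := W.three_le
  have hn0 : (0 : ℝ) < n := by exact_mod_cast (by omega : 0 < n)
  have key : ∀ (j j' : ℕ) (w w' x : ℕ), w ≤ L → w' ≤ L → W.z w = Cell.mk r x →
      W.z w' = Cell.mk r x → 1 - (j : ℝ) / (2 * n) - 2 * (1 / (64 * n)) ≤ W.v w →
      W.v w' ≤ 1 - (j' : ℝ) / (2 * n) → j < n → j' < j + 1 := by
    intro j j' w w' x hw hw' h1 h2 h3 h4 hjn
    have hd : (j : ℝ) / (2 * n) ≤ 1 / 2 := by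
      rw [div_le_div_iff₀ (by positivity) (by norm_num)]
      have : (j : ℝ) ≤ n := by exact_mod_cast hjn.le
      linarith
    have heps := W.eps_le
    have heta := W.eta_le
    have h5 : |W.v w - W.v w'| < 1 / (16 * n) := by
      rcases W.close w hw w' hw' (by rw [h1, h2]; exact Cell.Adj.refl _) with h | h
      · exact h.2
      · have h : W.v w < 1 / (16 * n) := h.1
        linarith
    have h6 := abs_lt.1 h5
    have h7 : (j' : ℝ) / (2 * n) - j / (2 * n) < 1 / (2 * n) := by
      have : (2 : ℝ) * (1 / (64 * n)) + 1 / (16 * n) < 1 / (2 * n) := by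
        field_simp
        norm_num
      linarith
    have h8 : (j' : ℝ) / (2 * n) < (j + 1) / (2 * n) := by
      rw [add_div]; linarith
    have h9 := (div_lt_div_iff_of_pos_right (by positivity)).1 h8
    exact_mod_cast h9
  obtain ⟨w, hw, hw1, hw2⟩ := b1 x1 (rev_Seg.2 a2)
  obtain ⟨w', hw', hw1', hw2'⟩ := a1 x2 (rev_Seg.1 b2)
  rw [rev_z] at hw1
  rw [rev_v] at hw2
  have c1 := key _ _ u1 (L - w) x1 a3 (by omega) a4 hw1 a5 hw2 (W.j_lt _)
  have c2 := key _ _ (L - u2) w' x2 (by omega) hw' b4 hw1' b5 hw2' (W.j_lt _)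
  omega

lemma link_aux {r : Fin m} {k t₀ t₁ : ℕ} (h01 : t₀ ≤ t₁) (ht₁ : t₁ ≤ L) (h0 : W.lo none)
    (hz0 : W.z t₀ = none) (hz1 : W.z t₁ = Cell.mk r k) (hF : W.Far r k)
    (hfirst : ∀ y < k, ¬ W.Far r y) :
    ∃ s ≤ L, ∃ t ≤ L, ∃ x, W.z s = Cell.mk r x ∧ (∀ y ≤ x, W.lo (Cell.mk r y)) ∧
      W.z t = Cell.mk r k ∧ W.K s ≤ W.K t + 1 ∧ W.K t ≤ W.K s + 1 := by
  classical
  obtain ⟨k₁, -, -, hk₀⟩ := id hF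
  have hk₀' : ∃ y, ¬ W.lo (Cell.mk r y) := hk₀.imp fun _ h => h.2
  obtain ⟨q, hq, hql⟩ : ∃ q, ¬ W.lo (Cell.mk r q) ∧ ∀ y < q, W.lo (Cell.mk r y) :=
    ⟨Nat.find hk₀', Nat.find_spec hk₀', fun y hy => not_not.1 (Nat.find_min hk₀' hy)⟩
  have hqk : q < k := by
    obtain ⟨y, hy, hy'⟩ := hk₀
    by_contra h
    exact hy' (hql y (by omega))
  obtain ⟨x, rfl⟩ : ∃ x, q = x + 1 := by
    rcases q with _ | x
    · exact absurd h0 hq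
    · exact ⟨x, rfl⟩
  have hex : ∃ t, t₀ ≤ t ∧ W.z t = Cell.mk r k := ⟨t₁, h01, hz1⟩
  obtain ⟨t, ht0, htz, htt, htmin⟩ : ∃ t, t₀ ≤ t ∧ W.z t = Cell.mk r k ∧ t ≤ t₁ ∧
      ∀ u, t₀ ≤ u → u < t → W.z u ≠ Cell.mk r k :=
    ⟨Nat.find hex, (Nat.find_spec hex).1, (Nat.find_spec hex).2, Nat.find_min' hex ⟨h01, hz1⟩,
      fun u hu hu' h => Nat.find_min hex hu' ⟨hu, h⟩⟩
  have hs0 : Cell.sgn r (W.z t₀) = 0 := by rw [hz0]; rfl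
  have hst : Cell.sgn r (W.z t) = k := by rw [htz]; simp
  have hstep : ∀ a b, b ≤ t → ∀ u, a ≤ u → u < b →
      |Cell.sgn r (W.z u) - Cell.sgn r (W.z (u + 1))| ≤ 1 :=
    fun a b hb u _ hu' => abs_sgn_le r (by omega)
  have hlt : ∀ u, t₀ ≤ u → u < t → Cell.sgn r (W.z u) < k := by
    intro u hu hu'
    by_contra h
    obtain ⟨w, hw1, hw2, hw3⟩ := exists_eq_of_steps (u := fun u => Cell.sgn r (W.z u)) (v := k)
      hu (hstep _ _ hu'.le) (by omega) (by omega)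
    exact htmin w hw1 (by omega) (Cell.eq_mk_of_sgn hw3)
  let P : ℕ → Prop := fun u => t₀ ≤ u ∧ Cell.sgn r (W.z u) = x
  obtain ⟨u₀, hu1, hu2, hu3⟩ := exists_eq_of_steps (u := fun u => Cell.sgn r (W.z u)) (v := x)
    ht0 (hstep _ _ le_rfl) (by omega) (by omega)
  set s := Nat.findGreatest P t
  have hsP : P s := Nat.findGreatest_spec (P := P) hu2 ⟨hu1, hu3⟩
  have hs_le : s ≤ t := Nat.findGreatest_le t
  have hsx : Cell.sgn r (W.z s) = x := hsP.2
  have hst' : s < t := by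
    rcases hs_le.lt_or_eq with h | h
    · exact h
    · rw [h, hst] at hsx; omega
  have hgt : ∀ u, s < u → u ≤ t → (x : ℤ) < Cell.sgn r (W.z u) := by
    intro u hu hu'
    by_contra h
    obtain ⟨w, hw1, hw2, hw3⟩ := exists_eq_of_steps (u := fun u => Cell.sgn r (W.z u)) (v := x)
      hu' (hstep _ _ le_rfl) (by omega) (by omega)
    exact Nat.findGreatest_is_greatest (P := P) (by omega : s < w) hw2
      ⟨by have := hsP.1; omega, hw3⟩
  have hv : ∀ u, s < u → u < t → W.v u < 2 / 5 := by
    intro u hu hu'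
    by_contra h
    have h1 := hgt u hu hu'.le
    have h2 := hlt u (by have := hsP.1; omega) hu'
    obtain ⟨y, hy⟩ : ∃ y : ℕ, Cell.sgn r (W.z u) = y := ⟨(Cell.sgn r (W.z u)).toNat, by omega⟩
    have hy' := Cell.eq_mk_of_sgn hy
    have hlo : W.lo (Cell.mk r y) := ⟨u, by omega, hy', by linarith⟩
    have hyx : y ≠ x + 1 := by
      rintro rfl
      exact hq hlo
    refine hfirst y (by omega) ⟨y, ⟨u, by omega, hy', by linarith⟩, fun w hw hw' => ?_, x + 1,
      by omega, hq⟩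
    obtain rfl : w = y := by omega
    exact hlo
  have hfl : ∀ u, s ≤ u → u ≤ t → ⌊W.p u⌋₊ = ⌊W.p s⌋₊ := by
    intro u hu
    induction u, hu using Nat.le_induction with
    | base => exact fun _ => rfl
    | succ u hu ih =>
      intro hu'
      rw [← ih (by omega)]
      have hnb := W.nb_succ (t := u) (by omega)
      rcases hu.eq_or_lt with rfl | hlt'
      · by_cases hst2 : s + 1 < t
        · exact (floor_leg_of_v_lt hnb.symm (hv _ (by omega) hst2)).1
        · have e : s + 1 = t := by omega
          have := abs_le.1 (hstep 0 t le_rfl s (by omega) hst')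
          rw [e] at this
          omega
      · exact (floor_leg_of_v_lt hnb (hv u hlt' (by omega))).1.symm
  have h1 := W.floor_eq_K_or s
  have h2 := W.floor_eq_K_or t
  have h3 := hfl t hst'.le le_rfl
  exact ⟨s, by omega, t, by omega, x, Cell.eq_mk_of_sgn hsx, fun y hy => hql y (by omega), htz,
    by omega, by omega⟩

lemma dir_eq_none {r : Fin m} {x : ℕ} (h : ∀ y ≤ x, W.lo (Cell.mk r y)) :
    W.dir (Cell.mk r x) = W.dir none := by
  induction x with
  | zero => rfl
  | succ x ih =>
    rw [← ih fun y hy => h y (by omega)]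
    exact dir_eq_of_adj (h x (by omega)) (h (x + 1) le_rfl) (Or.inr ⟨r, x, Or.inl ⟨rfl, rfl⟩⟩)

lemma link {r : Fin m} {k : ℕ} (h0 : W.lo none) (hF : W.Far r k)
    (hfirst : ∀ y < k, ¬ W.Far r y) :
    ∃ a b : ℕ, a % n = W.dir none ∧ b % n = W.dir (Cell.mk r k) ∧ a ≤ b + 1 ∧ b ≤ a + 1 := by
  obtain ⟨t₀, h1, h2, -⟩ := id h0
  obtain ⟨t₁, h3, h4, -⟩ := hF.lo
  suffices h : ∃ s ≤ L, ∃ t ≤ L, ∃ x, W.z s = Cell.mk r x ∧ (∀ y ≤ x, W.lo (Cell.mk r y)) ∧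
      W.z t = Cell.mk r k ∧ W.K s ≤ W.K t + 1 ∧ W.K t ≤ W.K s + 1 by
    obtain ⟨s, hs, t, ht, x, h5, h6, h7, h8, h9⟩ := h
    refine ⟨W.K s, W.K t, ?_, ?_, h8, h9⟩
    · rw [← dir_eq_none h6]
      exact dir_eq (h6 x le_rfl) hs (h5 ▸ Cell.Adj.refl _)
    · exact dir_eq hF.lo ht (h7 ▸ Cell.Adj.refl _)
  rcases le_total t₀ t₁ with h | h
  · exact link_aux h h3 h0 h2 h4 hF hfirst
  · obtain ⟨s, hs, t, ht, x, h5, h6, h7, h8, h9⟩ := link_aux (W := W.rev) (t₀ := L - t₀)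
      (t₁ := L - t₁) (r := r) (k := k) (by omega) (by omega) (rev_lo.2 h0)
      (by rw [rev_z, show L - (L - t₀) = t₀ by omega, h2])
      (by rw [rev_z, show L - (L - t₁) = t₁ by omega, h4]) (rev_Far.2 hF)
      (fun y hy => by rw [rev_Far]; exact hfirst y hy)
    exact ⟨L - s, by omega, L - t, by omega, x, h5, fun y hy => rev_lo.1 (h6 y hy), h7, h8, h9⟩

lemma exists_lt_notMem {n : ℕ} {S : Finset ℕ} (h : S.card < n) : ∃ a < n, a ∉ S := by
  obtain ⟨a, h1, h2⟩ := Finset.exists_mem_notMem_of_card_lt_card (s := S) (t := Finset.range n)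
    (by simpa using h)
  exact ⟨a, Finset.mem_range.1 h1, h2⟩

/-- A direction avoided by the label over the centre and by the first far intervals. -/
lemma exists_center_dir (W : LabelledWalk n m L) (hm : m = 1 ∨ (4 ≤ n ∧ 0 < m ∧ m < n)) :
    ∃ a < n, (W.lo none → a ≠ W.dir none) ∧
      ∀ r k, W.Far r k → (∀ y < k, ¬ W.Far r y) → a ≠ W.dir (Cell.mk r k) := by
  classical
  have h3 := W.three_le
  by_cases h0 : W.lo none
  · rcases eq_or_ne m 1 with rfl | hm1
    · by_cases hex : ∃ k, W.Far 0 k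
      · obtain ⟨a, ha, ha'⟩ := exists_lt_notMem (n := n)
          (S := {W.dir none, W.dir (Cell.mk 0 (Nat.find hex))})
          (lt_of_le_of_lt Finset.card_le_two (by omega))
        simp only [Finset.mem_insert, Finset.mem_singleton, not_or] at ha'
        refine ⟨a, ha, fun _ => ha'.1, fun r k hF hf => ?_⟩
        obtain rfl : r = 0 := Subsingleton.elim _ _
        have : k = Nat.find hex := by
          refine le_antisymm ?_ (Nat.find_min' hex hF)
          by_contra h
          exact hf _ (by omega) (Nat.find_spec hex)
        rw [this]; exact ha'.2
      · obtain ⟨a, ha, ha'⟩ := exists_lt_notMem (n := n) (S := {W.dir none}) (by simp; omega)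
        simp only [Finset.mem_singleton] at ha'
        refine ⟨a, ha, fun _ => ha', fun r k hF _ => ?_⟩
        obtain rfl : r = 0 := Subsingleton.elim _ _
        exact absurd ⟨k, hF⟩ hex
    · obtain ⟨h4, -⟩ := hm.resolve_left hm1
      set i := W.dir none with hi
      obtain ⟨a, ha, ha'⟩ := exists_lt_notMem (n := n) (S := {i, (i + 1) % n, (i + (n - 1)) % n})
        (lt_of_le_of_lt Finset.card_le_three (by omega))
      simp only [Finset.mem_insert, Finset.mem_singleton, not_or] at ha'
      refine ⟨a, ha, fun _ => ha'.1, fun r k hF hf heq => ?_⟩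
      obtain ⟨b, c, h5, h6, h7, h8⟩ := link h0 hF hf
      have : c = b ∨ c = b + 1 ∨ b = c + 1 := by omega
      rcases this with rfl | rfl | rfl
      · exact ha'.1 (by rw [heq, ← h6, h5])
      · exact ha'.2.1 (by rw [heq, ← h6, hi, ← h5, Nat.mod_add_mod])
      · refine ha'.2.2 ?_
        rw [heq, ← h6, hi, ← h5, Nat.mod_add_mod, show c + 1 + (n - 1) = c + n by omega,
          Nat.add_mod_right]
  · have hmn : m < n := by omega
    let f : Fin m → ℕ := fun r => if hex : ∃ k, W.Far r k then W.dir (Cell.mk r (Nat.find hex))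
      else 0
    obtain ⟨a, ha, ha'⟩ := exists_lt_notMem (n := n) (S := Finset.univ.image f)
      (lt_of_le_of_lt Finset.card_image_le (by simpa using hmn))
    refine ⟨a, ha, fun h => absurd h h0, fun r k hF hf heq => ha' ?_⟩
    rw [Finset.mem_image]
    have hex : ∃ k, W.Far r k := ⟨k, hF⟩
    refine ⟨r, Finset.mem_univ _, ?_⟩
    have : k = Nat.find hex := by
      refine le_antisymm ?_ (Nat.find_min' hex hF)
      by_contra h
      exact hf _ (by omega) (Nat.find_spec hex)
    simp only [f, dif_pos hex, heq, this]

variable (W) in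
/-- Cells in a far interval. -/
def FarCell : Cell m → Prop
  | none => False
  | some (r, k) => W.Far r (k + 1)

lemma farCell_mk {r : Fin m} {k : ℕ} : W.FarCell (Cell.mk r k) ↔ W.Far r k := by
  cases k with
  | zero => exact ⟨False.elim, fun h => absurd h.pos (lt_irrefl 0)⟩
  | succ k => exact Iff.rfl

lemma FarCell.lo {c : Cell m} (h : W.FarCell c) : W.lo c := by
  rcases c with _ | ⟨r, k⟩
  · exact h.elim
  · exact Far.lo (k := k + 1) h

/-- A choice of avoided directions, constant between far intervals. -/
lemma exists_dirs (W : LabelledWalk n m L) (hm : m = 1 ∨ (4 ≤ n ∧ 0 < m ∧ m < n)) :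
    ∃ a : Cell m → ℕ, (∀ c, a c < n) ∧
      (∀ c c', Cell.Adj c c' → ¬ W.FarCell c → ¬ W.FarCell c' → a c = a c') ∧
      (∀ c c', Cell.Adj c c' → ¬ W.FarCell c → W.FarCell c' → a c ≠ W.dir c') ∧
      ∀ t ≤ L, ¬ W.FarCell (W.z t) → W.K t % n ≠ a (W.z t) ∨ W.v t < 2 / 5 := by
  classical
  obtain ⟨aC, haC, haC0, haCF⟩ := W.exists_center_dir hm
  have h3 := W.three_le
  have hpick : ∀ x y : ℕ, ∃ a < n, a ≠ x ∧ a ≠ y := fun x y => by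
    obtain ⟨a, ha, ha'⟩ := exists_lt_notMem (n := n) (S := {x, y})
      (lt_of_le_of_lt Finset.card_le_two (by omega))
    simp only [Finset.mem_insert, Finset.mem_singleton, not_or] at ha'
    exact ⟨a, ha, ha'⟩
  choose pick hpick1 hpick2 hpick3 using hpick
  let below : Fin m → ℕ → ℕ := fun r k => Nat.findGreatest (W.Far r) k
  let above : Fin m → ℕ → ℕ := fun r k => sInf {y | k < y ∧ W.Far r y}
  let A : Fin m → ℕ → ℕ := fun r k => if below r k = 0 then aC else
    pick (W.dir (Cell.mk r (below r k))) (W.dir (Cell.mk r (above r k)))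
  let a : Cell m → ℕ := fun c => match c with
    | none => aC
    | some (r, k) => A r (k + 1)
  have haA : ∀ r k, a (Cell.mk r k) = A r k := by
    intro r k
    cases k with
    | zero => simp [a, A, below, Cell.mk]
    | succ k => rfl
  have hb0 : ∀ r k, below r k = 0 → ∀ y ≤ k, ¬ W.Far r y := by
    intro r k h y hy hF
    have h1 := Nat.findGreatest_eq_zero_iff.1 h hF.pos hy
    exact h1 hF
  have hsucc : ∀ r k, ¬ W.Far r k → ¬ W.Far r (k + 1) → A r k = A r (k + 1) := by
    intro r k _ h2
    have e1 : below r (k + 1) = below r k := by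
      simp only [below, Nat.findGreatest_succ, if_neg h2]
    have e2 : above r (k + 1) = above r k := by
      simp only [above]
      congr 1
      ext y
      constructor
      · exact fun h => ⟨by have := h.1; omega, h.2⟩
      · rintro ⟨h, h'⟩
        refine ⟨lt_of_le_of_ne h ?_, h'⟩
        rintro rfl
        exact h2 h'
    simp only [A, e1, e2]
  refine ⟨a, ?_, ?_, ?_, ?_⟩
  · rintro (_ | ⟨r, k⟩)
    · exact haC
    · change A r (k + 1) < n
      simp only [A]
      split_ifs
      · exact haC
      · exact hpick1 _ _
  · rintro c c' (rfl | ⟨r, k, ⟨rfl, rfl⟩ | ⟨rfl, rfl⟩⟩) h1 h2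
    · rfl
    · rw [farCell_mk] at h1 h2
      rw [haA, haA, hsucc r k h1 h2]
    · rw [farCell_mk] at h1 h2
      rw [haA, haA, hsucc r k h2 h1]
  · rintro c c' (rfl | ⟨r, k, ⟨rfl, rfl⟩ | ⟨rfl, rfl⟩⟩) h1 h2
    · exact absurd h2 h1
    · rw [farCell_mk] at h1 h2
      rw [haA]
      simp only [A]
      split_ifs with hb
      · refine haCF r (k + 1) h2 fun y hy => hb0 r k hb y (by omega)
      · have : above r k = k + 1 := by
          refine le_antisymm (Nat.sInf_le ⟨by omega, h2⟩) ?_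
          exact (Nat.sInf_mem (s := {y | k < y ∧ W.Far r y}) ⟨k + 1, by omega, h2⟩).1
        rw [this]
        exact hpick3 _ _
    · rw [farCell_mk] at h1 h2
      rw [haA]
      have : below r (k + 1) = k := by
        simp only [below, Nat.findGreatest_succ, if_neg h1]
        exact Nat.findGreatest_eq h2
      simp only [A, this]
      rw [if_neg h2.pos.ne']
      exact hpick2 _ _
  · intro t ht hF
    by_contra! hcon
    obtain ⟨hK, hv⟩ := hcon
    have hmm : m ≠ 0 := by
      rintro rfl
      omega
    obtain ⟨r, k, hz⟩ := Cell.exists_eq_mk (⟨0, by omega⟩ : Fin m) (W.z t)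
    rw [hz, farCell_mk] at hF
    have hhi : W.hi (Cell.mk r k) := ⟨t, ht, hz, by linarith⟩
    have hlo : W.lo (Cell.mk r k) := ⟨t, ht, hz, by linarith⟩
    have hall : ∀ y ≤ k, W.lo (Cell.mk r y) := by
      intro y hy
      rcases hy.eq_or_lt with rfl | hy
      · exact hlo
      · by_contra hy'
        refine hF ⟨k, hhi, fun w hw hw' => ?_, y, hy, hy'⟩
        obtain rfl : w = k := by omega
        exact hlo
    have hnF : ∀ y ≤ k, ¬ W.Far r y := by
      rintro y hy ⟨-, -, -, w, hw, hw'⟩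
      exact hw' (hall w (by omega))
    have hb : below r k = 0 := by
      simp only [below]
      rw [Nat.findGreatest_eq_zero_iff]
      exact fun y _ hy => hnF y hy
    rw [hz, haA] at hK
    simp only [A, hb, if_true] at hK
    apply haC0 (hall 0 (by omega))
    rw [← hK, ← dir_eq_none hall]
    exact dir_eq hlo ht (hz ▸ Cell.Adj.refl _)

/-- Two visits to the same cell occur at nearby points of the spider. -/
theorem near_of_eq (W : LabelledWalk n m L) (hm : m = 1 ∨ (4 ≤ n ∧ 0 < m ∧ m < n)) {s t : ℕ}
    (hs : s ≤ L) (ht : t ≤ L) (hz : W.z s = W.z t) :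
    (W.j s = W.j t ∧ |W.p s - W.p t| ≤ n) ∨ (W.p s ≤ n ∧ W.p t ≤ n) := by
  obtain ⟨a, ha, ha2, ha3, ha4⟩ := W.exists_dirs hm
  have h3 := W.three_le
  have key : ∀ d s t, t = s + d → t ≤ L → W.z s = W.z t →
      (W.FarCell (W.z s) → W.Y s t) ∧ (¬ W.FarCell (W.z s) → W.R (a (W.z s)) s t) := by
    intro d
    induction d using Nat.strong_induction_on with
    | _ d ih =>
    intro s t hd ht hz
    rcases Nat.eq_zero_or_pos d with rfl | hdpos
    · obtain rfl : t = s := by omega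
      exact ⟨fun _ => ⟨rfl, Or.inl rfl⟩, fun _ => ⟨rfl, Or.inr rfl⟩⟩
    by_cases hret : ∃ u, s < u ∧ u < t ∧ W.z u = W.z s
    · obtain ⟨u, hu1, hu2, hu3⟩ := hret
      obtain ⟨h1, h2⟩ := ih (u - s) (by omega) s u (by omega) (by omega) hu3.symm
      obtain ⟨h4, h5⟩ := ih (t - u) (by omega) u t (by omega) ht (hu3.trans hz)
      rw [hu3] at h4 h5
      exact ⟨fun h => (h1 h).trans (h4 h), fun h => (h2 h).trans (h5 h)⟩
    push Not at hret
    have hnb := W.nb_succ (t := s) (by omega)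
    by_cases hd1 : d = 1
    · obtain rfl : t = s + 1 := by omega
      exact ⟨fun h => Y_of_nb hnb (v_of_lo h.lo (by omega) (Cell.Adj.refl _)),
        fun h => R_of_nb (ha _) hnb (ha4 s (by omega) h)⟩
    have hnb' : W.Nb (t - 1) t := by
      have := W.nb_succ (t := t - 1) (by omega)
      rwa [show t - 1 + 1 = t by omega] at this
    have hadj := W.adj s (by omega)
    have hadj' : Cell.Adj (W.z s) (W.z (t - 1)) := by
      have := W.adj (t - 1) (by omega)
      rw [show t - 1 + 1 = t by omega, ← hz] at this
      exact this.symm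
    have hcz : W.z (s + 1) = W.z (t - 1) :=
      Cell.eq_of_walk_avoiding (c := W.z s) (by omega) (fun k _ _ => W.adj k (by omega))
        (fun k _ _ => hret k (by omega) (by omega)) hadj hadj'
    obtain ⟨ih1, ih2⟩ := ih (d - 2) (by omega) (s + 1) (t - 1) (by omega) (by omega) hcz
    by_cases hF' : W.FarCell (W.z (s + 1))
    · obtain ⟨hKK, hleg⟩ := ih1 hF'
      have hv1 := v_of_lo hF'.lo (t := s + 1) (by omega) (Cell.Adj.refl _)
      have hv2 := v_of_lo hF'.lo (t := t - 1) (by omega) (hcz ▸ Cell.Adj.refl _)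
      refine ⟨fun hF => ?_, fun hF => ?_⟩
      · exact ((Y_of_nb hnb.symm hv1).symm.trans ⟨hKK, hleg⟩).trans (Y_of_nb hnb' hv2)
      · have hdir := ha3 _ _ hadj hF hF'
        rw [← dir_eq hF'.lo (t := s + 1) (by omega) (Cell.Adj.refl _)] at hdir
        refine ((R_of_nb_K (ha _) hnb.symm (K_eq_of_nb hnb.symm hv1) hdir.symm).symm.trans ?_).trans
          (R_of_nb_K (ha _) hnb' (K_eq_of_nb hnb' hv2) (hKK ▸ hdir.symm))
        have e1 := W.countMod_floor (ha (W.z s)) hdir.symm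
        have e2 := W.countMod_floor (ha (W.z s)) (hKK ▸ hdir.symm)
        refine ⟨by rw [e1, e2, hKK], ?_⟩
        rcases hleg with hleg | hKn
        · exact Or.inr hleg
        by_cases hKa : W.K (s + 1) < a (W.z s)
        · left
          rw [e1, countMod_eq_zero (ha _)]
          exact hKa
        right
        rw [Nat.mod_eq_of_lt hKn] at hdir
        have hm0 : 0 < m := by omega
        obtain ⟨r, k, hrk⟩ := Cell.exists_eq_mk (⟨0, hm0⟩ : Fin m) (W.z (s + 1))
        have hFrk : W.Far r k := by rwa [hrk, farCell_mk] at hF'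
        refine leg_eq_of_loop ht (by omega) hrk (hcz ▸ hrk) hz hFrk ?_
          (fun u hu hu' => hret u hu hu') (by omega) hKn hKK
        intro hlo
        obtain ⟨k', rfl⟩ : ∃ k', k = k' + 1 := ⟨k - 1, by have := hFrk.pos; omega⟩
        rw [hrk] at hadj
        rcases hadj.symm.eq_of_ne (fun h => hF (h ▸ hrk ▸ hF')) with h | h
        · rw [h] at hlo hF
          exact hF (farCell_mk.2 (hFrk.of_succ hlo))
        · rw [h] at hlo hF
          exact hF (farCell_mk.2 (hFrk.succ hlo))
    · have hR := ih2 hF'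
      refine ⟨fun hF => ?_, fun hF => ?_⟩
      · have hv1 := v_of_lo hF.lo (t := s) (by omega) (Cell.Adj.refl _)
        have hv2 := v_of_lo hF.lo (t := t) (by omega) (hz ▸ Cell.Adj.refl _)
        have hd1 := dir_eq hF.lo (t := s) (by omega) (Cell.Adj.refl _)
        have hd2 := dir_eq hF.lo (t := t) (by omega) (hz ▸ Cell.Adj.refl _)
        have hdir := ha3 _ _ hadj.symm hF' hF
        have hr := ((R_of_nb_K (ha _) hnb (K_eq_of_nb hnb hv1) (hd1.trans_ne hdir.symm)).trans
          hR).trans (R_of_nb_K (ha _) hnb'.symm (K_eq_of_nb hnb'.symm hv2)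
            (hd2.trans_ne hdir.symm)).symm
        have e1 := W.countMod_floor (ha _) (hd1.trans_ne hdir.symm)
        have e2 := W.countMod_floor (ha _) (hd2.trans_ne hdir.symm)
        obtain ⟨hr1, hr2⟩ := hr
        rw [e1, e2] at hr1
        refine ⟨eq_of_countMod (ha _) (hd1.trans hd2.symm) hr1, ?_⟩
        rcases hr2 with hr2 | hr2
        · right
          rw [e1, countMod_eq_zero (ha _)] at hr2
          exact hr2.trans (ha _)
        · exact Or.inl hr2
      · have haa := ha2 _ _ hadj hF hF'
        rw [← haa] at hR
        exact ((R_of_nb (ha _) hnb (ha4 s (by omega) hF)).trans hR).trans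
          (R_of_nb (ha _) hnb'.symm (hz ▸ ha4 t (by omega) (hz ▸ hF))).symm
  have main : ∀ s t, s ≤ t → t ≤ L → W.z s = W.z t →
      (W.j s = W.j t ∧ |W.p s - W.p t| ≤ n) ∨ (W.p s ≤ n ∧ W.p t ≤ n) := by
    intro s t hst ht hz
    obtain ⟨h1, h2⟩ := key (t - s) s t (by omega) ht hz
    have hn3 : (3 : ℝ) ≤ n := by exact_mod_cast h3
    by_cases hF : W.FarCell (W.z s)
    · obtain ⟨h4, h5⟩ := h1 hF
      have hb1 := abs_le.1 (W.abs_p_sub_K s)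
      have hb2 := abs_le.1 (W.abs_p_sub_K t)
      rw [← h4] at hb2
      rcases h5 with h5 | h5
      · refine Or.inl ⟨h5, ?_⟩
        rw [abs_le]; constructor <;> linarith
      · have : (W.K s : ℝ) + 1 ≤ n := by exact_mod_cast h5
        exact Or.inr ⟨by linarith, by linarith⟩
    · obtain ⟨h4, h5⟩ := h2 hF
      have hb1 := Nat.lt_floor_add_one (W.p s)
      have hb2 := Nat.lt_floor_add_one (W.p t)
      have hb3 := Nat.floor_le (W.p_nonneg s)
      have hb4 := Nat.floor_le (W.p_nonneg t)
      rcases h5 with h5 | h5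
      · right
        have h6 := h5
        rw [h4] at h6
        rw [countMod_eq_zero (ha _)] at h5 h6
        have h7 : (⌊W.p s⌋₊ : ℝ) + 1 ≤ n := by exact_mod_cast h5.trans (ha _)
        have h8 : (⌊W.p t⌋₊ : ℝ) + 1 ≤ n := by exact_mod_cast h6.trans (ha _)
        exact ⟨by linarith, by linarith⟩
      · refine Or.inl ⟨h5, ?_⟩
        have h6 : (⌊W.p s⌋₊ : ℝ) + 1 ≤ ⌊W.p t⌋₊ + n := by
          exact_mod_cast lt_of_countMod (ha _) h4
        have h7 : (⌊W.p t⌋₊ : ℝ) + 1 ≤ ⌊W.p s⌋₊ + n := by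
          exact_mod_cast lt_of_countMod (ha _) h4.symm
        rw [abs_le]; constructor <;> linarith
  rcases le_total s t with h | h
  · exact main s t h ht hz
  · rcases main t s h hs hz.symm with h' | h'
    · exact Or.inl ⟨h'.1.symm, by rw [abs_sub_comm]; exact h'.2⟩
    · exact Or.inr ⟨h'.2, h'.1⟩

end LabelledWalk

/-! ### The spider -/

/-- The spider with `n` unit legs along the coordinate half-axes. -/
def spiderSet (n : ℕ) : Set (Fin n → ℝ) :=
  {x | (∀ i, 0 ≤ x i) ∧ (∀ i, x i ≤ 1) ∧ ∀ i j, i ≠ j → x i = 0 ∨ x j = 0}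

/-- The spider as a space. -/
abbrev Spider (n : ℕ) : Type := ↥(spiderSet n)

namespace Spider

variable {n : ℕ}

lemma single_mem {i : Fin n} {r : ℝ} (hr : r ∈ Set.Icc (0 : ℝ) 1) :
    Pi.single i r ∈ spiderSet n := by
  refine ⟨fun j => ?_, fun j => ?_, fun j k hjk => ?_⟩
  · by_cases h : j = i
    · subst h; simpa using hr.1
    · simp [h]
  · by_cases h : j = i
    · subst h; simpa using hr.2
    · simp [h]
  · by_cases h : j = i
    · right
      rw [Pi.single_eq_of_ne]
      rintro rfl
      exact hjk h
    · left; simp [h]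

/-- The point at distance `r`, truncated to `[0, 1]`, on leg `i`. -/
noncomputable def pt (i : Fin n) (r : ℝ) : Spider n :=
  ⟨Pi.single i (Set.projIcc (0 : ℝ) 1 zero_le_one r : ℝ), single_mem (Set.projIcc 0 1 _ r).2⟩

lemma coe_pt {i : Fin n} {r : ℝ} (h0 : 0 ≤ r) (h1 : r ≤ 1) :
    (pt i r : Fin n → ℝ) = Pi.single i r := by
  simp only [pt]
  rw [Set.projIcc_of_mem zero_le_one ⟨h0, h1⟩]

lemma continuous_pt (i : Fin n) : Continuous (pt i) := by
  apply Continuous.subtype_mk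
  exact (continuous_single i).comp (continuous_subtype_val.comp continuous_projIcc)

/-- The distance from the centre. -/
noncomputable def rad (x : Spider n) : ℝ := ∑ i, x.1 i

lemma continuous_rad : Continuous (rad : Spider n → ℝ) := by
  unfold rad
  fun_prop

lemma rad_nonneg (x : Spider n) : 0 ≤ rad x := Finset.sum_nonneg fun i _ => x.2.1 i

/-- The signed distance from the centre, positive on leg `i`. -/
noncomputable def coord (i : Fin n) (x : Spider n) : ℝ := 2 * x.1 i - rad x

lemma continuous_coord (i : Fin n) : Continuous (coord i) := by
  exact (continuous_const.mul ((continuous_apply i).comp continuous_subtype_val)).sub continuous_rad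

lemma rad_eq_of_pos {x : Spider n} {i : Fin n} (h : 0 < x.1 i) : rad x = x.1 i := by
  unfold rad
  rw [Finset.sum_eq_single i]
  · intro j _ hj
    exact (x.2.2.2 j i hj).resolve_right h.ne'
  · simp

lemma eq_pt_of_pos {x : Spider n} {i : Fin n} (h : 0 < x.1 i) : x = pt i (rad x) := by
  rw [rad_eq_of_pos h]
  apply Subtype.ext
  rw [coe_pt h.le (x.2.2.1 i)]
  ext j
  by_cases hj : j = i
  · subst hj; simp
  · rw [Pi.single_eq_of_ne hj]
    exact (x.2.2.2 j i hj).resolve_right h.ne'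

lemma eq_of_rad_eq_zero {x : Spider n} (h : rad x = 0) (i : Fin n) : x = pt i 0 := by
  apply Subtype.ext
  rw [coe_pt le_rfl zero_le_one, Pi.single_zero]
  ext j
  have := (Finset.sum_eq_zero_iff_of_nonneg fun i _ => x.2.1 i).1 h j (Finset.mem_univ j)
  exact this

lemma exists_eq_pt [NeZero n] (x : Spider n) : ∃ i, x = pt i (rad x) := by
  by_cases h : ∃ i, 0 < x.1 i
  · exact h.imp fun i hi => eq_pt_of_pos hi
  · push Not at h
    have h0 : rad x = 0 := Finset.sum_eq_zero fun i _ => le_antisymm (h i) (x.2.1 i)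
    exact ⟨0, h0 ▸ eq_of_rad_eq_zero h0 0⟩

lemma rad_pt {i : Fin n} {r : ℝ} (h0 : 0 ≤ r) (h1 : r ≤ 1) : rad (pt i r) = r := by
  simp [rad, coe_pt h0 h1]

lemma rad_le_one [NeZero n] (x : Spider n) : rad x ≤ 1 := by
  obtain ⟨i, hi⟩ := exists_eq_pt x
  rcases (rad_nonneg x).eq_or_lt with h | h
  · rw [← h]; exact zero_le_one
  · by_cases h' : ∃ i, 0 < x.1 i
    · obtain ⟨i, hi⟩ := h'
      rw [rad_eq_of_pos hi]
      exact x.2.2.1 i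
    · push Not at h'
      have h0 : rad x = 0 := Finset.sum_eq_zero fun i _ => le_antisymm (h' i) (x.2.1 i)
      rw [h0]; exact zero_le_one

lemma coord_pt {i : Fin n} {r : ℝ} (h0 : 0 ≤ r) (h1 : r ≤ 1) : coord i (pt i r) = r := by
  simp [coord, rad_pt h0 h1, coe_pt h0 h1]; ring

lemma eq_pt_of_coord [NeZero n] {i : Fin n} {x : Spider n} (h : 0 ≤ coord i x) :
    x = pt i (coord i x) := by
  by_cases hp : 0 < x.1 i
  · have h1 := rad_eq_of_pos hp
    have h2 : coord i x = rad x := by rw [coord, h1]; ring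
    rw [h2]
    exact eq_pt_of_pos hp
  · have h1 : x.1 i = 0 := le_antisymm (not_lt.1 hp) (x.2.1 i)
    have h2 := rad_nonneg x
    have h3 : rad x = 0 := by rw [coord, h1] at h; linarith
    have h4 : coord i x = 0 := by rw [coord, h1, h3]; ring
    rw [h4]
    exact eq_of_rad_eq_zero h3 i

lemma pt_zero (i j : Fin n) : pt i 0 = pt j 0 := by
  apply Subtype.ext
  rw [coe_pt le_rfl zero_le_one, coe_pt le_rfl zero_le_one, Pi.single_zero, Pi.single_zero]

lemma dist_pt_same {i : Fin n} {r s : ℝ} (h0 : 0 ≤ r) (h1 : r ≤ 1) (h2 : 0 ≤ s) (h3 : s ≤ 1) :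
    dist (pt i r) (pt i s) = |r - s| := by
  rw [Subtype.dist_eq, coe_pt h0 h1, coe_pt h2 h3]
  rw [← Real.dist_eq]
  apply le_antisymm
  · rw [dist_pi_le_iff dist_nonneg]
    intro j
    by_cases hj : j = i
    · subst hj; simp
    · simp [hj]
  · have := dist_le_pi_dist (Pi.single i r : Fin n → ℝ) (Pi.single i s) i
    simpa using this

lemma dist_pt_ne {i j : Fin n} (hij : i ≠ j) {r s : ℝ} (h0 : 0 ≤ r) (h1 : r ≤ 1) (h2 : 0 ≤ s)
    (h3 : s ≤ 1) : dist (pt i r) (pt j s) = max r s := by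
  rw [Subtype.dist_eq, coe_pt h0 h1, coe_pt h2 h3]
  apply le_antisymm
  · rw [dist_pi_le_iff (le_max_of_le_left h0)]
    intro k
    by_cases hk : k = i
    · subst hk
      simp [hij, abs_of_nonneg h0]
    · by_cases hk' : k = j
      · subst hk'
        simp [hk, Real.dist_eq, abs_of_nonneg h2]
      · simp [hk, hk', h0]
  · apply max_le
    · have := dist_le_pi_dist (Pi.single i r : Fin n → ℝ) (Pi.single j s) i
      simpa [hij, Real.dist_eq, abs_of_nonneg h0] using this
    · have := dist_le_pi_dist (Pi.single i r : Fin n → ℝ) (Pi.single j s) j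
      simpa [hij.symm, Real.dist_eq, abs_of_nonneg h2] using this

lemma abs_rad_sub_le [NeZero n] (x y : Spider n) : |rad x - rad y| ≤ dist x y := by
  obtain ⟨i, hi⟩ := exists_eq_pt x
  obtain ⟨j, hj⟩ := exists_eq_pt y
  have hx0 := rad_nonneg x
  have hx1 := rad_le_one x
  have hy0 := rad_nonneg y
  have hy1 := rad_le_one y
  generalize rad x = r at *
  generalize rad y = s at *
  subst hi hj
  by_cases hij : i = j
  · subst hij
    rw [dist_pt_same hx0 hx1 hy0 hy1]
  · rw [dist_pt_ne hij hx0 hx1 hy0 hy1, abs_le]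
    constructor
    · linarith [le_max_right r s]
    · linarith [le_max_left r s]

lemma isCompact_spiderSet (n : ℕ) : IsCompact (spiderSet n) := by
  have hsub : spiderSet n ⊆ Set.Icc (0 : Fin n → ℝ) 1 := fun x hx => ⟨hx.1, hx.2.1⟩
  refine isCompact_Icc.of_isClosed_subset ?_ hsub
  simp only [spiderSet, Set.ofPred_and, Set.ofPred_forall]
  refine IsClosed.inter ?_ (IsClosed.inter ?_ ?_)
  · exact isClosed_iInter fun i => isClosed_le continuous_const (continuous_apply i)
  · exact isClosed_iInter fun i => isClosed_le (continuous_apply i) continuous_const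
  · refine isClosed_iInter fun i => isClosed_iInter fun j => isClosed_iInter fun _ => ?_
    simp only [Set.ofPred_or]
    exact (isClosed_eq (continuous_apply i) continuous_const).union
      (isClosed_eq (continuous_apply j) continuous_const)

instance : CompactSpace (Spider n) := isCompact_iff_compactSpace.1 (isCompact_spiderSet n)

/-- A connected set containing points on both sides of a point contains it. -/
lemma mem_of_isPreconnected [NeZero n] {S : Set (Spider n)} (hS : IsPreconnected S) {x y : Spider n}
    (hx : x ∈ S) (hy : y ∈ S) {i : Fin n} {r : ℝ} (hr : 0 ≤ r) (h1 : coord i x ≤ r)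
    (h2 : r ≤ coord i y) : pt i r ∈ S := by
  obtain ⟨z, hz, hzr⟩ := hS.intermediate_value hx hy (continuous_coord i).continuousOn ⟨h1, h2⟩
  have : z = pt i (coord i z) := eq_pt_of_coord (hzr ▸ hr)
  rw [hzr] at this
  exact this ▸ hz

lemma coord_le_rad (i : Fin n) (x : Spider n) : coord i x ≤ rad x := by
  have : x.1 i ≤ rad x := Finset.single_le_sum (f := x.1) (fun i _ => x.2.1 i) (Finset.mem_univ i)
  unfold coord; linarith

end Spider

/-! ### The folding map -/

/-- The number of folds on each leg. -/
def folds (n : ℕ) : ℕ := 100 * n * n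

lemma foldVal_nonneg {n j : ℕ} {p : ℝ} (hj : j < n) (hp : 0 ≤ p) : 0 ≤ foldVal n j p := by
  have h1 := half_le_foldAmp (p := p) hj
  have h2 := abs_sub_floor_half hp
  exact mul_nonneg (by linarith) (by linarith)

lemma foldVal_le_one {n j : ℕ} {p : ℝ} (hj : j < n) (hp : 0 ≤ p) : foldVal n j p ≤ 1 := by
  have h1 := half_le_foldAmp (p := p) hj
  have h3 := foldAmp_le_one (n := n) (j := j) hp
  have h2 := abs_sub_floor_half hp
  have h4 := abs_nonneg (p - (⌊p + 1 / 2⌋₊ : ℝ))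
  unfold foldVal
  nlinarith

namespace Spider

variable {n : ℕ}

/-- The folding map in coordinates. -/
noncomputable def foldRaw (n : ℕ) (x : Fin n → ℝ) (i : Fin n) : ℝ :=
  (1 - ∑ j : Fin n, ((j : ℕ) : ℝ) / (2 * n) * min 1 (2 * (folds n * x j))) *
    ∑ k ∈ (Finset.range (folds n + 1)).filter (fun k => k % n = i),
      max 0 (1 - 2 * |folds n * (∑ j, x j) - k|)

lemma continuous_foldRaw (n : ℕ) : Continuous (foldRaw n) := by
  unfold foldRaw
  fun_prop

lemma foldRaw_single [NeZero n] {j : Fin n} {r : ℝ} (h0 : 0 ≤ r) (h1 : r ≤ 1) :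
    foldRaw n (Pi.single j r) =
      Pi.single (Fin.ofNat n ⌊folds n * r + 1 / 2⌋₊) (foldVal n j (folds n * r)) := by
  set p : ℝ := folds n * r with hp
  have hp0 : 0 ≤ p := by positivity
  have hpN : p ≤ folds n := by
    have : (0 : ℝ) ≤ folds n := by positivity
    rw [hp]; nlinarith
  set K := ⌊p + 1 / 2⌋₊ with hK
  have hKN : K < folds n + 1 := by
    rw [hK, Nat.floor_lt (by linarith)]
    push_cast
    linarith
  have e1 : ∑ i : Fin n, ((i : ℕ) : ℝ) / (2 * n) *
      min 1 (2 * (folds n * (Pi.single j r : Fin n → ℝ) i)) =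
      ((j : ℕ) : ℝ) / (2 * n) * min 1 (2 * p) := by
    rw [Finset.sum_eq_single j]
    · simp [hp]
    · intro i _ hi
      simp [hi]
    · simp
  have e2 : ∑ i, (Pi.single j r : Fin n → ℝ) i = r := by simp
  have hk : ∀ k, k ≠ K → max 0 (1 - 2 * |p - k|) = 0 := by
    intro k hk
    apply max_eq_left
    by_contra h
    exact hk (floor_half_eq hp0 (by linarith)).symm
  have hKv : max 0 (1 - 2 * |p - K|) = 1 - 2 * |p - K| := by
    apply max_eq_right
    have := abs_sub_floor_half hp0
    linarith
  ext i
  unfold foldRaw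
  rw [e1, e2, ← hp]
  by_cases hi : i = Fin.ofNat n K
  · subst hi
    rw [Pi.single_eq_same, Finset.sum_eq_single K, hKv]
    · rfl
    · intro k _ hne
      exact hk k hne
    · intro h
      exact absurd (Finset.mem_filter.2 ⟨Finset.mem_range.2 hKN, by simp⟩) h
  · rw [Pi.single_eq_of_ne hi, Finset.sum_eq_zero, mul_zero]
    intro k hkm
    apply hk
    rintro rfl
    apply hi
    apply Fin.ext
    simpa using (Finset.mem_filter.1 hkm).2.symm

lemma foldRaw_mem [NeZero n] (x : Spider n) : foldRaw n x ∈ spiderSet n := by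
  obtain ⟨i, hi⟩ := exists_eq_pt x
  have h0 := rad_nonneg x
  have h1 := rad_le_one x
  rw [hi, coe_pt h0 h1, foldRaw_single h0 h1]
  have : (0 : ℝ) ≤ folds n * rad x := by positivity
  exact single_mem ⟨foldVal_nonneg i.2 this, foldVal_le_one i.2 this⟩

/-- The folding map. -/
noncomputable def fold (n : ℕ) [NeZero n] (x : Spider n) : Spider n := ⟨foldRaw n x, foldRaw_mem x⟩

lemma continuous_fold (n : ℕ) [NeZero n] : Continuous (fold n) :=
  ((continuous_foldRaw n).comp continuous_subtype_val).subtype_mk _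

lemma fold_pt [NeZero n] {j : Fin n} {r : ℝ} (h0 : 0 ≤ r) (h1 : r ≤ 1) :
    fold n (pt j r) = pt (Fin.ofNat n ⌊folds n * r + 1 / 2⌋₊) (foldVal n j (folds n * r)) := by
  apply Subtype.ext
  have : (0 : ℝ) ≤ folds n * r := by positivity
  rw [coe_pt (foldVal_nonneg j.2 this) (foldVal_le_one j.2 this)]
  exact (congrArg (foldRaw n) (coe_pt h0 h1)).trans (foldRaw_single h0 h1)

lemma folds_pos [NeZero n] : (0 : ℝ) < folds n := by
  have := NeZero.pos n
  unfold folds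
  positivity

lemma hundred_le_folds [NeZero n] : (100 : ℝ) * n ≤ folds n := by
  have h : 1 ≤ n := NeZero.pos n
  have h : 100 * n ≤ folds n := by unfold folds; nlinarith
  exact_mod_cast h

/-- The centre. -/
noncomputable def center (n : ℕ) [NeZero n] : Spider n := pt 0 0

/-- Tips of the folds. -/
def Tip (x : Spider n) : Prop := ∃ (i : Fin n) (k : ℕ), k ≤ folds n ∧ x = pt i (k / folds n)

/-- Images of tips of the folds. -/
def TipImage (x : Spider n) : Prop :=
  ∃ (i : Fin n) (j : ℕ), j < n ∧ x = pt i (1 - (j : ℝ) / (2 * n))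

lemma half_le_rad_of_tipImage {x : Spider n} (h : TipImage x) : 1 / 2 ≤ rad x := by
  obtain ⟨i, j, hj, rfl⟩ := h
  have hn : (0 : ℝ) < n := by exact_mod_cast (by omega : 0 < n)
  have h1 : (j : ℝ) / (2 * n) ≤ 1 / 2 := by
    rw [div_le_div_iff₀ (by positivity) (by norm_num)]
    have : (j : ℝ) ≤ n := by exact_mod_cast hj.le
    linarith
  have h2 : (0 : ℝ) ≤ (j : ℝ) / (2 * n) := by positivity
  rw [rad_pt] <;> linarith

lemma foldVal_nat {n j : ℕ} (k : ℕ) :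
    foldVal n j k = 1 - (if k = 0 then 0 else j : ℕ) / (2 * n) := by
  have : ⌊(k : ℝ) + 1 / 2⌋₊ = k := floor_half_eq (by positivity) (by simp)
  rw [foldVal, this, foldAmp]
  split_ifs with h
  · simp [h]
  · have : (1 : ℝ) ≤ k := by exact_mod_cast Nat.one_le_iff_ne_zero.2 h
    rw [min_eq_left (by linarith)]
    simp

lemma tipImage_fold_of_tip [NeZero n] {x : Spider n} (h : Tip x) : TipImage (fold n x) := by
  obtain ⟨i, k, hk, rfl⟩ := h
  have hN := folds_pos (n := n)
  have hk' : (k : ℝ) ≤ folds n := by exact_mod_cast hk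
  rw [fold_pt (by positivity) (by rw [div_le_one hN]; exact hk'), mul_div_cancel₀ _ hN.ne',
    foldVal_nat]
  refine ⟨_, _, ?_, rfl⟩
  split_ifs
  · exact NeZero.pos n
  · exact i.2

lemma tip_of_tipImage {x : Spider n} (h : TipImage x) : Tip x := by
  obtain ⟨i, j, hj, rfl⟩ := h
  have hn : (0 : ℝ) < n := by exact_mod_cast (by omega : 0 < n)
  have hle : 50 * n * j ≤ 100 * n * n := by nlinarith
  refine ⟨i, folds n - 50 * n * j, Nat.sub_le _ _, ?_⟩
  congr 1
  unfold folds
  rw [Nat.cast_sub hle]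
  push_cast
  field_simp
  ring

lemma foldVal_injOn {n j k : ℕ} (hn : 2 ≤ n) (hj : j < n) {p q : ℝ} (hp : (k : ℝ) < p)
    (hp' : p < k + 1) (hq : (k : ℝ) < q) (hq' : q < k + 1)
    (h : (⌊p + 1 / 2⌋₊ % n = ⌊q + 1 / 2⌋₊ % n ∧ foldVal n j p = foldVal n j q) ∨
      (foldVal n j p = 0 ∧ foldVal n j q = 0)) : p = q := by
  have hk0 : (0 : ℝ) ≤ k := by positivity
  have hz : ∀ x : ℝ, (k : ℝ) < x → x < k + 1 → foldVal n j x = 0 → x = k + 1 / 2 := by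
    intro x h1 h2 h3
    have h4 := half_le_foldAmp (p := x) hj
    have h5 : 1 - 2 * |x - (⌊x + 1 / 2⌋₊ : ℝ)| = 0 := by
      rcases mul_eq_zero.1 h3 with h | h
      · linarith
      · exact h
    by_contra hne
    rcases lt_or_gt_of_ne hne with h | h
    · rw [floor_half_eq (k := k) (by linarith) (by rw [abs_of_pos] <;> linarith),
        abs_of_pos (by linarith)] at h5
      linarith
    · rw [floor_half_eq (k := k + 1) (by linarith)
        (by push_cast; rw [abs_of_neg] <;> linarith)] at h5
      push_cast at h5
      rw [abs_of_neg (by linarith)] at h5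
      linarith
  have hlow : ∀ x : ℝ, (k : ℝ) < x → x < k + 1 / 2 → ⌊x + 1 / 2⌋₊ = k ∧
      foldVal n j x = foldAmp n j x * (1 - 2 * (x - k)) := by
    intro x h1 h2
    have e := floor_half_eq (p := x) (k := k) (by linarith) (by rw [abs_of_pos] <;> linarith)
    rw [foldVal, e, abs_of_pos (by linarith)]
    exact ⟨rfl, rfl⟩
  have hhigh : ∀ x : ℝ, (k : ℝ) + 1 / 2 ≤ x → x < k + 1 → ⌊x + 1 / 2⌋₊ = k + 1 ∧
      foldVal n j x = (1 - (j : ℝ) / (2 * n)) * (1 - 2 * (k + 1 - x)) := by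
    intro x h1 h2
    have e : ⌊x + 1 / 2⌋₊ = k + 1 := by
      rw [Nat.floor_eq_iff (by linarith)]
      push_cast
      constructor <;> linarith
    refine ⟨e, ?_⟩
    rw [foldVal, e, foldAmp, min_eq_left (by linarith)]
    push_cast
    rw [abs_of_neg (by linarith)]
    ring
  rcases h with ⟨hK, hv⟩ | ⟨h1, h2⟩
  swap
  · rw [hz p hp hp' h1, hz q hq hq' h2]
  have hkk : k % n ≠ (k + 1) % n := by
    intro h
    have : (k + 1) % n = (k + 0) % n := by rw [add_zero, h]
    have h3 : (1 : ℕ) ≡ 0 [MOD n] := Nat.ModEq.add_left_cancel' k this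
    have h4 : (1 : ℕ) % n = 0 % n := h3
    rw [Nat.mod_eq_of_lt (by omega), Nat.zero_mod] at h4
    omega
  have hlowmono : ∀ x y : ℝ, (k : ℝ) < x → x < y → y < k + 1 / 2 →
      foldVal n j y < foldVal n j x := by
    intro x y h1 h2 h3
    rw [(hlow x h1 (by linarith)).2, (hlow y (by linarith) h3).2]
    have h4 : foldAmp n j y ≤ foldAmp n j x := by
      unfold foldAmp
      have : (0 : ℝ) ≤ (j : ℝ) / (2 * n) := by positivity
      have : min 1 (2 * x) ≤ min 1 (2 * y) := min_le_min_left _ (by linarith)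
      nlinarith
    have h5 := half_le_foldAmp (p := x) hj
    have h6 := half_le_foldAmp (p := y) hj
    nlinarith
  rcases lt_or_ge p (k + 1 / 2) with h1 | h1 <;> rcases lt_or_ge q (k + 1 / 2) with h2 | h2
  · rcases lt_trichotomy p q with h | h | h
    · exact absurd hv (hlowmono p q hp h h2).ne'
    · exact h
    · exact absurd hv (hlowmono q p hq h h1).ne
  · rw [(hlow p hp h1).1, (hhigh q h2 hq').1] at hK
    exact absurd hK hkk
  · rw [(hhigh p h1 hp').1, (hlow q hq h2).1] at hK
    exact absurd hK.symm hkk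
  · rw [(hhigh p h1 hp').2, (hhigh q h2 hq').2] at hv
    have hn : (0 : ℝ) < n := by exact_mod_cast (by omega : 0 < n)
    have h3 : (j : ℝ) / (2 * n) ≤ 1 / 2 := by
      rw [div_le_div_iff₀ (by positivity) (by norm_num)]
      have : (j : ℝ) ≤ n := by exact_mod_cast hj.le
      linarith
    have := mul_left_cancel₀ (show (1 - (j : ℝ) / (2 * n)) ≠ 0 by linarith) hv
    linarith

lemma pt_inj {i j : Fin n} {r s : ℝ} (h0 : 0 ≤ r) (h1 : r ≤ 1) (h2 : 0 ≤ s) (h3 : s ≤ 1)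
    (h : pt i r = pt j s) : (i = j ∧ r = s) ∨ (r = 0 ∧ s = 0) := by
  by_cases hij : i = j
  · subst hij
    left
    refine ⟨rfl, ?_⟩
    have := congrArg rad h
    rwa [rad_pt h0 h1, rad_pt h2 h3] at this
  · right
    have := dist_pt_ne hij h0 h1 h2 h3
    rw [h, dist_self] at this
    have a := le_max_left r s
    have b := le_max_right r s
    constructor <;> linarith

/-- A path identifying two points under iterated folding passes over the image of a tip. -/
lemma exists_tipImage [NeZero n] (hn : 2 ≤ n) {γ : ℝ → Spider n} {a b : ℝ} (hγ : Continuous γ)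
    (hinj : Set.InjOn γ (Set.Icc a b)) (s : ℕ) : ∀ t t', a ≤ t → t < t' → t' ≤ b →
    (fold n)^[s] (γ t) = (fold n)^[s] (γ t') →
    ∃ r ∈ Set.Icc t t', TipImage ((fold n)^[s] (γ r)) := by
  have hN := folds_pos (n := n)
  induction s with
  | zero =>
    intro t t' h1 h2 h3 h4
    exact absurd (hinj ⟨h1, by linarith⟩ ⟨by linarith, h3⟩ h4) h2.ne
  | succ s ih =>
    intro t t' h1 h2 h3 h4
    simp only [Function.iterate_succ', Function.comp_apply] at h4 ⊢
    by_cases hw : (fold n)^[s] (γ t) = (fold n)^[s] (γ t')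
    · obtain ⟨r, hr, hr'⟩ := ih t t' h1 h2 h3 hw
      exact ⟨r, hr, tipImage_fold_of_tip (tip_of_tipImage hr')⟩
    by_contra hno
    push Not at hno
    set q : ℝ → Spider n := fun r => (fold n)^[s] (γ r) with hq
    have hqc : Continuous q := ((continuous_fold n).iterate s).comp hγ
    have hnt : ∀ r ∈ Set.Icc t t', ¬ Tip (q r) := fun r hr h => hno r hr (tipImage_fold_of_tip h)
    obtain ⟨j, hj⟩ := exists_eq_pt (q t)
    set k := ⌊folds n * rad (q t)⌋₊ with hk
    have hr0 := rad_nonneg (q t)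
    have hr1 := rad_le_one (q t)
    have hfl := Nat.floor_le (show 0 ≤ folds n * rad (q t) by positivity)
    have hfl' := Nat.lt_floor_add_one (folds n * rad (q t))
    rw [← hk] at hfl hfl'
    have hct : coord j (q t) = rad (q t) := by
      conv_lhs => rw [hj]
      exact coord_pt hr0 hr1
    have hhit : ∀ l : ℕ, ∀ r ∈ Set.Icc t t', folds n * coord j (q r) ≠ l := by
      intro l r hr h
      have hc : coord j (q r) = l / folds n := by
        rw [← h]; field_simp
      have h0 : 0 ≤ coord j (q r) := by rw [hc]; positivity
      have hle : coord j (q r) ≤ 1 := (coord_le_rad j _).trans (rad_le_one _)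
      refine hnt r hr ⟨j, l, ?_, ?_⟩
      · rw [hc, div_le_one hN] at hle
        exact_mod_cast hle
      · rw [← hc]; exact eq_pt_of_coord h0
    have hcont : Continuous fun r => folds n * coord j (q r) :=
      continuous_const.mul ((continuous_coord j).comp hqc)
    have hgt : ∀ r ∈ Set.Icc t t', (k : ℝ) < folds n * coord j (q r) := by
      intro r hr
      by_contra h
      obtain ⟨r', hr', h'⟩ := intermediate_value_Icc' hr.1 hcont.continuousOn
        (show (k : ℝ) ∈ Set.Icc _ _ from ⟨not_lt.1 h, by simpa only [hct] using hfl⟩)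
      exact hhit k r' ⟨hr'.1, hr'.2.trans hr.2⟩ h'
    have hlt : ∀ r ∈ Set.Icc t t', folds n * coord j (q r) < (k : ℝ) + 1 := by
      intro r hr
      by_contra h
      obtain ⟨r', hr', h'⟩ := intermediate_value_Icc hr.1 hcont.continuousOn
        (show (k : ℝ) + 1 ∈ Set.Icc _ _ from ⟨by simpa only [hct] using hfl'.le, not_lt.1 h⟩)
      exact hhit (k + 1) r' ⟨hr'.1, hr'.2.trans hr.2⟩ (by push_cast; exact h')
    have hk0 : (0 : ℝ) ≤ k := by positivity
    have hc1 : ∀ r ∈ Set.Icc t t', 0 ≤ coord j (q r) := by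
      intro r hr
      have := hgt r hr
      by_contra h
      nlinarith
    have ht : t ∈ Set.Icc t t' := ⟨le_rfl, h2.le⟩
    have ht' : t' ∈ Set.Icc t t' := ⟨h2.le, le_rfl⟩
    have hle1 : ∀ r, coord j (q r) ≤ 1 := fun r => (coord_le_rad j _).trans (rad_le_one _)
    have e1 := eq_pt_of_coord (hc1 t ht)
    have e2 := eq_pt_of_coord (hc1 t' ht')
    change fold n (q t) = fold n (q t') at h4
    rw [e1, e2, fold_pt (hc1 t ht) (hle1 t), fold_pt (hc1 t' ht') (hle1 t')] at h4
    have hp1 : 0 ≤ folds n * coord j (q t) := hk0.trans (hgt t ht).le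
    have hp2 : 0 ≤ folds n * coord j (q t') := hk0.trans (hgt t' ht').le
    have h5 := pt_inj (foldVal_nonneg j.2 hp1) (foldVal_le_one j.2 hp1) (foldVal_nonneg j.2 hp2)
      (foldVal_le_one j.2 hp2) h4
    have h6 := foldVal_injOn hn j.2 (hgt t ht) (hlt t ht) (hgt t' ht') (hlt t' ht')
      (h5.imp (fun h => ⟨by simpa using congrArg Fin.val h.1, h.2⟩) id)
    apply hw
    change q t = q t'
    rw [e1, e2, mul_left_cancel₀ hN.ne' h6]

end Spider

namespace Spider

variable {n : ℕ}

lemma exists_fold_pt_eq [NeZero n] (y : Spider n) :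
    ∃ r ∈ Set.Icc (0 : ℝ) 1, fold n (pt 0 r) = y := by
  obtain ⟨i, hi⟩ := exists_eq_pt y
  have h0 := rad_nonneg y
  have h1 := rad_le_one y
  generalize rad y = v at *
  subst hi
  have hN := folds_pos (n := n)
  have hNn := hundred_le_folds (n := n)
  have hin : ((i : ℕ) : ℝ) + 1 ≤ n := by exact_mod_cast i.2
  have hi0 : (0 : ℝ) ≤ (i : ℕ) := by positivity
  have hr0 : 0 ≤ ((i : ℕ) + (1 - v) / 2) / folds n := div_nonneg (by linarith) hN.le
  have hr1 : ((i : ℕ) + (1 - v) / 2) / folds n ≤ 1 := by rw [div_le_one hN]; linarith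
  refine ⟨_, ⟨hr0, hr1⟩, ?_⟩
  rw [fold_pt hr0 hr1, mul_div_cancel₀ _ hN.ne']
  have hamp : ∀ p, foldAmp n ((0 : Fin n) : ℕ) p = 1 := fun p => by simp [foldAmp]
  rcases h0.eq_or_lt with hv | hv
  · subst hv
    have e : ⌊((i : ℕ) : ℝ) + (1 - 0) / 2 + 1 / 2⌋₊ = i + 1 := by
      rw [Nat.floor_eq_iff (by positivity)]
      push_cast
      constructor <;> linarith
    have e2 : foldVal n ((0 : Fin n) : ℕ) (((i : ℕ) : ℝ) + (1 - 0) / 2) = 0 := by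
      rw [foldVal, hamp, e, abs_of_neg (by push_cast; linarith)]
      push_cast; ring
    rw [e2]
    exact pt_zero _ _
  · have e : ⌊((i : ℕ) : ℝ) + (1 - v) / 2 + 1 / 2⌋₊ = i :=
      floor_half_eq (by linarith) (by rw [abs_of_nonneg] <;> linarith)
    have e2 : foldVal n ((0 : Fin n) : ℕ) (((i : ℕ) : ℝ) + (1 - v) / 2) = v := by
      rw [foldVal, hamp, e, abs_of_nonneg (by linarith)]
      ring
    rw [e2, e]
    congr 1
    exact Fin.ext (Nat.mod_eq_of_lt i.2)

lemma surjective_fold (n : ℕ) [NeZero n] : Function.Surjective (fold n) := fun y =>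
  let ⟨_, _, h⟩ := exists_fold_pt_eq y
  ⟨_, h⟩

lemma fold_center [NeZero n] : fold n (center n) = pt 0 1 := by
  rw [center, fold_pt le_rfl zero_le_one, mul_zero]
  have := foldVal_nat (n := n) (j := (0 : Fin n)) 0
  simp only [Nat.cast_zero] at this
  rw [this]
  norm_num

lemma eq_center [NeZero n] (i : Fin n) : pt i 0 = center n := pt_zero _ _

/-- A connected set containing the centre and the end of leg `0` folds onto everything. -/
lemma image_fold_eq_univ [NeZero n] {S : Set (Spider n)} (hS : IsPreconnected S)
    (h0 : center n ∈ S) (h1 : pt 0 1 ∈ S) : fold n '' S = Set.univ := by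
  refine Set.eq_univ_of_forall fun y => ?_
  obtain ⟨r, hr, hy⟩ := exists_fold_pt_eq y
  refine ⟨_, mem_of_isPreconnected hS h0 h1 hr.1 ?_ ?_, hy⟩
  · rw [center, coord_pt le_rfl zero_le_one]; exact hr.1
  · rw [coord_pt zero_le_one le_rfl]; exact hr.2

instance [NeZero n] : ConnectedSpace (Spider n) where
  isPreconnected_univ := by
    refine isPreconnected_of_forall (center n) fun y _ => ?_
    obtain ⟨i, hi⟩ := exists_eq_pt y
    refine ⟨pt i '' Set.Icc 0 1, Set.subset_univ _, ?_, ?_,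
      isPreconnected_Icc.image _ (continuous_pt i).continuousOn⟩
    · exact ⟨0, ⟨le_rfl, zero_le_one⟩, eq_center i⟩
    · exact ⟨rad y, ⟨rad_nonneg y, rad_le_one y⟩, hi.symm⟩
  toNonempty := ⟨center n⟩

/-- The embedding of the spider in the plane. -/
noncomputable def toPlane (n : ℕ) (x : Spider n) : ℂ :=
  ∑ i : Fin n, ((x.1 i : ℝ) : ℂ) * Complex.exp (2 * Real.pi * Complex.I * ((i : ℕ) : ℂ) / (n : ℂ))

lemma continuous_toPlane (n : ℕ) : Continuous (toPlane n) := by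
  exact continuous_finsetSum _ fun i _ => (Complex.continuous_ofReal.comp
    ((continuous_apply i).comp continuous_subtype_val)).mul continuous_const

lemma toPlane_pt {i : Fin n} {r : ℝ} (h0 : 0 ≤ r) (h1 : r ≤ 1) :
    toPlane n (pt i r) =
      (r : ℂ) * Complex.exp (2 * Real.pi * Complex.I * ((i : ℕ) : ℂ) / (n : ℂ)) := by
  unfold toPlane
  rw [coe_pt h0 h1, Finset.sum_eq_single i]
  · simp
  · intro j _ hj
    simp [hj]
  · simp

lemma injective_toPlane (n : ℕ) [NeZero n] : Function.Injective (toPlane n) := by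
  intro x y h
  obtain ⟨i, hi⟩ := exists_eq_pt x
  obtain ⟨j, hj⟩ := exists_eq_pt y
  have hx0 := rad_nonneg x
  have hx1 := rad_le_one x
  have hy0 := rad_nonneg y
  have hy1 := rad_le_one y
  generalize rad x = r at *
  generalize rad y = s at *
  subst hi hj
  rw [toPlane_pt hx0 hx1, toPlane_pt hy0 hy1] at h
  have hexp : ∀ i : ℕ, Complex.exp (2 * Real.pi * Complex.I * (i : ℂ) / (n : ℂ)) =
      Complex.exp (2 * Real.pi * Complex.I / (n : ℂ)) ^ i := by
    intro i
    rw [← Complex.exp_nat_mul]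
    congr 1
    ring
  have hprim := Complex.isPrimitiveRoot_exp n (NeZero.ne n)
  have hnorm : ‖Complex.exp (2 * Real.pi * Complex.I / (n : ℂ))‖ = 1 :=
    hprim.norm'_eq_one (NeZero.ne n)
  rw [hexp, hexp] at h
  have hrs : r = s := by
    have := congrArg norm h
    simpa [hnorm, abs_of_nonneg hx0, abs_of_nonneg hy0] using this
  subst hrs
  rcases hx0.eq_or_lt with hr | hr
  · subst hr
    exact pt_zero _ _
  · have hr' : (r : ℂ) ≠ 0 := by exact_mod_cast hr.ne'
    have := hprim.pow_inj i.2 j.2 (mul_left_cancel₀ hr' h)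
    rw [Fin.ext this]

lemma range_toPlane (n : ℕ) [NeZero n] : Set.range (toPlane n) = simpleOdSet n := by
  ext w
  constructor
  · rintro ⟨x, rfl⟩
    obtain ⟨i, hi⟩ := exists_eq_pt x
    refine ⟨rad x, i, ⟨rad_nonneg x, rad_le_one x⟩, i.2, ?_⟩
    conv_lhs => rw [hi]
    exact toPlane_pt (rad_nonneg x) (rad_le_one x)
  · rintro ⟨t, k, ht, hk, rfl⟩
    exact ⟨pt ⟨k, hk⟩ t, toPlane_pt ht.1 ht.2⟩

/-- The spider is the simple `n`-od. -/
noncomputable def homeo (n : ℕ) [NeZero n] : Spider n ≃ₜ simpleOdSet n :=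
  ((continuous_toPlane n).isClosedEmbedding (injective_toPlane n)).toIsEmbedding.toHomeomorph.trans
    (Homeomorph.setCongr (range_toPlane n))

end Spider

/-! ### Inverse limits -/

/-- `K` is the inverse limit of the iterates of `f`, with projections `π`. -/
structure IsInverseLimit {X K : Type*} [TopologicalSpace X] [TopologicalSpace K] (f : X → X)
    (π : ℕ → K → X) : Prop where
  continuous : ∀ k, Continuous (π k)
  comm : ∀ k x, f (π (k + 1) x) = π k x
  inj : ∀ x y, (∀ k, π k x = π k y) → x = y
  surj : ∀ k, Function.Surjective (π k)

namespace IsInverseLimit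

lemma exists_metricSpace {X K : Type} [TopologicalSpace X] [TopologicalSpace K]
    [TopologicalSpace.MetrizableSpace K] [hc : CompactSpace K] {f : X → X} {π : ℕ → K → X}
    (h : IsInverseLimit f π) :
    ∃ (L : Type) (_ : MetricSpace L) (ρ : ℕ → L → X), CompactSpace L ∧ IsInverseLimit f ρ :=
  ⟨K, TopologicalSpace.metrizableSpaceMetric K, π, hc, h⟩

/-- The inverse limit of a continuous surjection of a compact metric space exists. -/
lemma exists_of_surjective {X : Type} [MetricSpace X] [CompactSpace X] {f : X → X}
    (hf : Continuous f) (hs : Function.Surjective f) :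
    ∃ (K : Type) (_ : MetricSpace K) (π : ℕ → K → X), CompactSpace K ∧ IsInverseLimit f π := by
  have hcl : IsClosed {x : ℕ → X | ∀ k, f (x (k + 1)) = x k} := by
    rw [Set.ofPred_forall]
    exact isClosed_iInter fun k =>
      isClosed_eq (hf.comp (continuous_apply (k + 1))) (continuous_apply k)
  have hK : CompactSpace {x : ℕ → X | ∀ k, f (x (k + 1)) = x k} :=
    isCompact_iff_compactSpace.1 hcl.isCompact
  suffices h : IsInverseLimit f fun k (x : {x : ℕ → X | ∀ k, f (x (k + 1)) = x k}) => x.1 k from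
    h.exists_metricSpace
  refine ⟨fun k => (continuous_apply k).comp continuous_subtype_val,
    fun k x => x.2 k, fun x y h => Subtype.ext (funext h), ?_⟩
  intro k y
  obtain ⟨g, hg⟩ := hs.hasRightInverse
  refine ⟨⟨fun i => if k ≤ i then g^[i - k] y else f^[k - i] y, fun i => ?_⟩, by simp⟩
  dsimp only
  by_cases h : k ≤ i
  · rw [if_pos h, if_pos (by omega), show i + 1 - k = (i - k) + 1 by omega,
      Function.iterate_succ_apply', hg]
  · rw [if_neg h]
    by_cases h' : k ≤ i + 1
    · obtain rfl : k = i + 1 := by omega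
      simp
    · rw [if_neg h', show k - i = (k - (i + 1)) + 1 by omega, Function.iterate_succ_apply']

variable {X K : Type*} [MetricSpace X] [MetricSpace K] {f : X → X} {π : ℕ → K → X}

lemma iterate (h : IsInverseLimit f π) (k s : ℕ) (x : K) : f^[s] (π (k + s) x) = π k x := by
  induction s with
  | zero => rfl
  | succ s ih => rw [Function.iterate_succ_apply, ← add_assoc, h.comm, ih]

lemma eq_of_le (h : IsInverseLimit f π) {k m : ℕ} (hkm : k ≤ m) {x y : K} (hxy : π m x = π m y) :
    π k x = π k y := by
  obtain ⟨s, rfl⟩ := Nat.exists_eq_add_of_le hkm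
  rw [← h.iterate k s x, ← h.iterate k s y, hxy]

variable [CompactSpace K]

/-- Closed sets of pairs of distinct points are separated by far enough projections. -/
lemma exists_separates (h : IsInverseLimit f π) {F : Set (K × K)} (hF : IsClosed F)
    (hne : ∀ p ∈ F, p.1 ≠ p.2) : ∃ m, ∀ k, m ≤ k → ∀ p ∈ F, π k p.1 ≠ π k p.2 := by
  set G : ℕ → Set (K × K) := fun k => F ∩ {p | π k p.1 = π k p.2} with hG
  have hGc : ∀ k, IsClosed (G k) := fun k => hF.inter
    (isClosed_eq ((h.continuous k).comp continuous_fst) ((h.continuous k).comp continuous_snd))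
  by_contra hcon
  push Not at hcon
  have hGne : ∀ m, (G m).Nonempty := by
    intro m
    obtain ⟨k, hk, p, hp, hpk⟩ := hcon m
    exact ⟨p, hp, h.eq_of_le hk hpk⟩
  obtain ⟨p, hp⟩ := IsCompact.nonempty_iInter_of_sequence_nonempty_isCompact_isClosed G
    (fun k p hp => ⟨hp.1, h.eq_of_le (Nat.le_succ k) hp.2⟩) hGne (hGc 0).isCompact hGc
  rw [Set.mem_iInter] at hp
  exact hne p (hp 0).1 (h.inj _ _ fun k => (hp k).2)

lemma exists_dist_lt (h : IsInverseLimit f π) {ε : ℝ} (hε : 0 < ε) :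
    ∃ k, ∃ δ > 0, ∀ x y, dist (π k x) (π k y) < δ → dist x y < ε := by
  have hF : IsClosed {p : K × K | ε ≤ dist p.1 p.2} := isClosed_le continuous_const continuous_dist
  obtain ⟨k, hk⟩ := h.exists_separates hF (by
    rintro p hp heq
    rw [Set.mem_ofPred_eq, heq, dist_self] at hp
    linarith)
  refine ⟨k, ?_⟩
  rcases Set.eq_empty_or_nonempty {p : K × K | ε ≤ dist p.1 p.2} with he | hne
  · refine ⟨1, one_pos, fun x y _ => ?_⟩
    by_contra hxy
    have : (x, y) ∈ {p : K × K | ε ≤ dist p.1 p.2} := not_lt.1 hxy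
    rw [he] at this
    exact this
  · obtain ⟨q, hq, hmin⟩ := hF.isCompact.exists_isMinOn hne
      (((h.continuous k).comp continuous_fst).dist
        ((h.continuous k).comp continuous_snd)).continuousOn
    refine ⟨_, dist_pos.2 (hk k le_rfl q hq), fun x y hxy => ?_⟩
    by_contra hxy'
    have := hmin (show (x, y) ∈ {p : K × K | ε ≤ dist p.1 p.2} from not_lt.1 hxy')
    exact absurd hxy (not_lt.2 this)

lemma connectedSpace [ConnectedSpace X] (h : IsInverseLimit f π) : ConnectedSpace K := by
  have hne : Nonempty K := by
    obtain ⟨x⟩ := ‹ConnectedSpace X›.toNonempty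
    exact ⟨(h.surj 0 x).choose⟩
  suffices PreconnectedSpace K from { toPreconnectedSpace := this, toNonempty := hne }
  rw [preconnectedSpace_iff_clopen]
  intro s hs
  by_contra hcon
  push Not at hcon
  obtain ⟨h1, h2⟩ := hcon
  have hF : IsClosed (s ×ˢ sᶜ) := hs.isClosed.prod hs.compl.isClosed
  obtain ⟨m, hm⟩ := h.exists_separates hF (by
    rintro ⟨x, y⟩ ⟨hx, hy⟩ heq
    exact hy (heq ▸ hx))
  have hdisj : Disjoint (π m '' s) (π m '' sᶜ) := by
    rw [Set.disjoint_left]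
    rintro _ ⟨x, hx, rfl⟩ ⟨y, hy, hxy⟩
    exact hm m le_rfl (x, y) ⟨hx, hy⟩ hxy.symm
  have hun : π m '' s ∪ π m '' sᶜ = Set.univ := by
    rw [← Set.image_union, Set.union_compl_self, Set.image_univ, (h.surj m).range_eq]
  have hc1 : IsClosed (π m '' s) := (hs.isClosed.isCompact.image (h.continuous m)).isClosed
  have hc2 : IsClosed (π m '' sᶜ) := (hs.compl.isClosed.isCompact.image (h.continuous m)).isClosed
  have hcomp : (π m '' s)ᶜ = π m '' sᶜ :=
    (IsCompl.of_eq hdisj.inter_eq hun).compl_eq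
  have hclopen : IsClopen (π m '' s) := ⟨hc1, by rw [← isClosed_compl_iff, hcomp]; exact hc2⟩
  rcases isClopen_iff.1 hclopen with h' | h'
  · exact h1.ne_empty (Set.image_eq_empty.1 h')
  · rw [h', Set.compl_univ] at hcomp
    exact h2 (Set.compl_empty_iff.1 (Set.image_eq_empty.1 hcomp.symm))

lemma isLike {Y : Type*} [MetricSpace Y] (h : IsInverseLimit f π) (e : X ≃ₜ Y) : IsLike K Y := by
  intro ε hε
  obtain ⟨k, δ, hδ, hk⟩ := h.exists_dist_lt (half_pos hε)
  refine ⟨e ∘ π k, e.continuous.comp (h.continuous k), e.surjective.comp (h.surj k), fun y => ?_⟩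
  refine (Metric.diam_le_of_forall_dist_le (half_pos hε).le fun x hx x' hx' => ?_).trans_lt
    (half_lt_self hε)
  refine (hk x x' ?_).le
  have hx : e (π k x) = y := hx
  have hx' : e (π k x') = y := hx'
  rw [e.injective (hx.trans hx'.symm), dist_self]
  exact hδ

end IsInverseLimit

/-! ### Triods -/

section Triod

variable {K : Type*} [TopologicalSpace K]

lemma MutuallySeparated.symm {A B : Set K} (h : MutuallySeparated A B) : MutuallySeparated B A :=
  ⟨by rw [Set.inter_comm]; exact h.2, by rw [Set.inter_comm]; exact h.1⟩

lemma MutuallySeparated.union_right {A B D : Set K} (h : MutuallySeparated A B)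
    (h' : MutuallySeparated A D) : MutuallySeparated A (B ∪ D) :=
  ⟨by rw [closure_union, Set.inter_union_distrib_left, h.1, h'.1, Set.union_empty],
    by rw [Set.inter_union_distrib_left, h.2, h'.2, Set.union_empty]⟩

lemma isClosed_union_of_separated {C M A B : Set K} (hC : IsClosed C) (hM : IsClosed M)
    (h : C \ M = A ∪ B) (hs : MutuallySeparated A B) : IsClosed (M ∪ A) := by
  refine isClosed_of_closure_subset fun x hx => ?_
  rw [closure_union, hM.closure_eq] at hx
  rcases hx with hx | hx
  · exact Or.inl hx
  · by_contra hn
    rw [Set.mem_union, not_or] at hn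
    have hAC : A ⊆ C := fun y hy => (h ▸ Or.inl hy : y ∈ C \ M).1
    have : x ∈ A ∪ B := h ▸ ⟨closure_minimal hAC hC hx, hn.1⟩
    exact (hs.2 ▸ ⟨hx, this.resolve_left hn.2⟩ : x ∈ (∅ : Set K))

/-- Adding separated pieces of the complement to a subcontinuum gives a connected set. -/
lemma isPreconnected_union_of_separated {C M A B : Set K} (hC : IsClosed C)
    (hCc : IsPreconnected C) (hM : IsClosed M) (hMc : IsPreconnected M) (hMC : M ⊆ C)
    (h : C \ M = A ∪ B) (hs : MutuallySeparated A B) : IsPreconnected (M ∪ A) := by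
  have hA := isClosed_union_of_separated hC hM h hs
  have hB := isClosed_union_of_separated hC hM (h.trans (Set.union_comm A B)) hs.symm
  have key : ∀ t t' : Set K, IsClosed t → IsClosed t' → M ∪ A ⊆ t ∪ t' →
      (M ∪ A) ∩ (t ∩ t') = ∅ → M ⊆ t → M ∪ A ⊆ t ∨ M ∪ A ⊆ t' := by
    intro t t' ht ht' hsub hdis hMt
    have hmeet : ∀ x, x ∈ M ∪ A → x ∈ M ∪ B → x ∈ M := by
      rintro x (h1 | h1) (h2 | h2)
      · exact h1
      · exact h1
      · exact h2
      · exact (hs.1 ▸ ⟨h1, subset_closure h2⟩ : x ∈ (∅ : Set K)).elim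
    have hcov : C ⊆ ((M ∪ A) ∩ t ∪ (M ∪ B)) ∪ (M ∪ A) ∩ t' := by
      intro x hx
      by_cases hxM : x ∈ M
      · exact Or.inl (Or.inr (Or.inl hxM))
      · rcases (h ▸ ⟨hx, hxM⟩ : x ∈ A ∪ B) with hx | hx
        · rcases hsub (Or.inr hx) with h' | h'
          · exact Or.inl (Or.inl ⟨Or.inr hx, h'⟩)
          · exact Or.inr ⟨Or.inr hx, h'⟩
        · exact Or.inl (Or.inr (Or.inr hx))
    have hAC : M ∪ A ⊆ C := by
      rintro x (hx | hx)
      · exact hMC hx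
      · exact (h ▸ Or.inl hx : x ∈ C \ M).1
    rcases isPreconnected_iff_subset_of_disjoint_closed.1 hCc _ _ ((hA.inter ht).union hB)
      (hA.inter ht') hcov (by
        refine Set.eq_empty_of_forall_notMem ?_
        rintro x ⟨-, h1, h2⟩
        have h3 : x ∈ t := by
          rcases h1 with h1 | h1
          · exact h1.2
          · exact hMt (hmeet x h2.1 h1)
        exact (hdis ▸ ⟨h2.1, h3, h2.2⟩ : x ∈ (∅ : Set K))) with h' | h'
    · left
      intro x hx
      rcases h' (hAC hx) with h'' | h''
      · exact h''.2
      · exact hMt (hmeet x hx h'')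
    · right
      exact fun x hx => (h' (hAC hx)).2
  rw [isPreconnected_iff_subset_of_disjoint_closed]
  intro t t' ht ht' hsub hdis
  rcases isPreconnected_iff_subset_of_disjoint_closed.1 hMc t t' ht ht'
    (Set.subset_union_left.trans hsub) (Set.eq_empty_of_subset_empty
      (hdis ▸ Set.inter_subset_inter_left _ Set.subset_union_left)) with h' | h'
  · exact key t t' ht ht' hsub hdis h'
  · exact (key t' t ht' ht (Set.union_comm t t' ▸ hsub) (Set.inter_comm t t' ▸ hdis) h').symm

/-- A triod contains three subcontinua, each missing one of three points of the other two. -/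
lemma IsTriodSet.exists_three [T2Space K] {C : Set K} (hC : IsCompact C) (hCc : IsConnected C)
    (h : IsTriodSet C) : ∃ (E : Fin 3 → Set K) (x : Fin 3 → K), (∀ i, IsClosed (E i)) ∧
      (∀ i, IsPreconnected (E i)) ∧ ∀ i j, x i ∈ E j ↔ i ≠ j := by
  obtain ⟨M, A, B, D, hM, hMc, hMC, ⟨a, ha⟩, ⟨b, hb⟩, ⟨d, hd⟩, hcov, hAB, hAD, hBD⟩ := h
  have e1 : C \ M = (B ∪ D) ∪ A := by rw [hcov, Set.union_assoc, Set.union_comm]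
  have e2 : C \ M = (A ∪ D) ∪ B := by
    rw [hcov, Set.union_assoc, Set.union_assoc, Set.union_comm B]
  have s1 := (hAB.union_right hAD).symm
  have s2 := (hAB.symm.union_right hBD).symm
  have s3 := (hAD.symm.union_right hBD.symm).symm
  have hCM : ∀ x ∈ A ∪ B ∪ D, x ∉ M := fun x hx => (hcov ▸ hx : x ∈ C \ M).2
  have dj : ∀ {P Q : Set K}, MutuallySeparated P Q → ∀ x ∈ P, x ∉ Q := fun hs x h1 h2 =>
    (hs.1 ▸ ⟨h1, subset_closure h2⟩ : x ∈ (∅ : Set K))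
  have haM := hCM a (Or.inl (Or.inl ha))
  have hbM := hCM b (Or.inl (Or.inr hb))
  have hdM := hCM d (Or.inr hd)
  have haBD := dj s1.symm a ha
  have hbAD := dj s2.symm b hb
  have hdAB := dj s3.symm d hd
  rw [Set.mem_union, not_or] at haBD hbAD hdAB
  refine ⟨![M ∪ (B ∪ D), M ∪ (A ∪ D), M ∪ (A ∪ B)], ![a, b, d], ?_, ?_, ?_⟩
  · intro i
    fin_cases i
    · exact isClosed_union_of_separated hC.isClosed hM.isClosed e1 s1
    · exact isClosed_union_of_separated hC.isClosed hM.isClosed e2 s2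
    · exact isClosed_union_of_separated hC.isClosed hM.isClosed hcov s3
  · intro i
    fin_cases i
    · exact isPreconnected_union_of_separated hC.isClosed hCc.isPreconnected hM.isClosed
        hMc.isPreconnected hMC e1 s1
    · exact isPreconnected_union_of_separated hC.isClosed hCc.isPreconnected hM.isClosed
        hMc.isPreconnected hMC e2 s2
    · exact isPreconnected_union_of_separated hC.isClosed hCc.isPreconnected hM.isClosed
        hMc.isPreconnected hMC hcov s3
  · intro i j
    fin_cases i <;> fin_cases j <;> simp [haM, hbM, hdM, ha, hb, hd, haBD, hbAD, hdAB]

end Triod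

namespace Spider

variable {n : ℕ} [NeZero n]

lemma center_mem_of_three {S : Set (Spider n)} {S₁ S₂ : Set (Spider n)} (hS : IsPreconnected S)
    (hS₁ : IsPreconnected S₁) (hS₂ : IsPreconnected S₂) {y y₁ y₂ : Spider n} (hy : y ∉ S)
    (hy₁ : y₁ ∉ S₁) (hy₂ : y₂ ∉ S₂) (h1 : y₁ ∈ S) (h2 : y₂ ∈ S) (h3 : y ∈ S₁) (h4 : y₂ ∈ S₁)
    (h5 : y ∈ S₂) (h6 : y₁ ∈ S₂) : center n ∈ S := by
  by_contra hc
  obtain ⟨r, hr⟩ := exists_eq_pt y₁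
  have hc1 : 0 ≤ coord r y₁ := by
    rw [hr, coord_pt (rad_nonneg _) (rad_le_one _)]
    exact rad_nonneg _
  have hc2 : 0 ≤ coord r y₂ := by
    by_contra h
    exact hc (eq_center r ▸ mem_of_isPreconnected hS h2 h1 le_rfl (not_le.1 h).le hc1)
  have e1 := eq_pt_of_coord hc1
  have e2 := eq_pt_of_coord hc2
  rcases le_total (coord r y₁) (coord r y₂) with h | h
  · rcases le_total (coord r y) (coord r y₁) with h' | h'
    · exact hy₁ (e1 ▸ mem_of_isPreconnected hS₁ h3 h4 hc1 h' h)
    · rcases le_total (coord r y) (coord r y₂) with h'' | h''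
      · have e := eq_pt_of_coord (hc1.trans h')
        exact hy (e ▸ mem_of_isPreconnected hS h1 h2 (hc1.trans h') h' h'')
      · exact hy₂ (e2 ▸ mem_of_isPreconnected hS₂ h6 h5 hc2 h h'')
  · rcases le_total (coord r y) (coord r y₂) with h' | h'
    · exact hy₂ (e2 ▸ mem_of_isPreconnected hS₂ h5 h6 hc2 h' h)
    · rcases le_total (coord r y) (coord r y₁) with h'' | h''
      · have e := eq_pt_of_coord (hc2.trans h')
        exact hy (e ▸ mem_of_isPreconnected hS h2 h1 (hc2.trans h') h' h'')
      · exact hy₁ (e1 ▸ mem_of_isPreconnected hS₁ h4 h3 hc1 h h'')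

/-- The inverse limit of the folding map is atriodic. -/
lemma atriodicSpace {K : Type*} [MetricSpace K] [CompactSpace K] {π : ℕ → K → Spider n}
    (h : IsInverseLimit (fold n) π) : AtriodicSpace K := by
  intro C hC hCc htri
  obtain ⟨E, x, hE, hEc, hxE⟩ := htri.exists_three hC hCc
  obtain ⟨m, hm⟩ := h.exists_separates (F := ⋃ i, {x i} ×ˢ E i)
    (isClosed_iUnion_of_finite fun i => isClosed_singleton.prod (hE i)) (by
      rintro ⟨p, q⟩ hp heq
      obtain ⟨i, hi1, hi2⟩ := Set.mem_iUnion.1 hp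
      have h1 : p = x i := hi1
      have h2 : p = q := heq
      have h3 : x i ∈ E i := by rw [← h1, h2]; exact hi2
      exact (hxE i i).1 h3 rfl)
  have hmiss : ∀ k, m ≤ k → ∀ i, π k (x i) ∉ π k '' E i := by
    rintro k hk i ⟨z, hz, hzx⟩
    exact hm k hk (x i, z) (Set.mem_iUnion.2 ⟨i, rfl, hz⟩) hzx.symm
  have hpre : ∀ k i, IsPreconnected (π k '' E i) := fun k i =>
    (hEc i).image _ (h.continuous k).continuousOn
  have hin : ∀ k i j, i ≠ j → π k (x i) ∈ π k '' E j := fun k i j hij =>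
    Set.mem_image_of_mem _ ((hxE i j).2 hij)
  have hcen : ∀ k, m ≤ k → center n ∈ π k '' E 0 := fun k hk =>
    center_mem_of_three (hpre k 0) (hpre k 1) (hpre k 2) (hmiss k hk 0) (hmiss k hk 1)
      (hmiss k hk 2) (hin k 1 0 (by decide)) (hin k 2 0 (by decide)) (hin k 0 1 (by decide))
      (hin k 2 1 (by decide)) (hin k 0 2 (by decide)) (hin k 1 2 (by decide))
  have himg : ∀ k, fold n '' (π (k + 1) '' E 0) = π k '' E 0 := fun k => by
    rw [← Set.image_comp]
    exact Set.image_congr fun z _ => h.comm k z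
  have htip : pt 0 1 ∈ π (m + 1) '' E 0 := by
    rw [← himg, ← fold_center]
    exact Set.mem_image_of_mem _ (hcen _ (by omega))
  have := image_fold_eq_univ (hpre (m + 1) 0) (hcen _ (by omega)) htip
  rw [himg] at this
  exact hmiss m le_rfl 0 (this ▸ Set.mem_univ _)

end Spider

namespace Cell

/-- A discrete spider cannot be mapped to one with fewer legs so that no end of a leg is mapped to
the same cell as a point of another leg. -/
lemma exists_end_eq {n m H : ℕ} (hn : 3 ≤ n) (hm : 0 < m) (hmn : m < n) {z : Fin n → ℕ → Cell m}
    (h0 : ∀ i j, z i 0 = z j 0) (hadj : ∀ i, ∀ a < H, Adj (z i a) (z i (a + 1))) :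
    ∃ i j, i ≠ j ∧ ∃ a ≤ H, z i H = z j a := by
  by_contra hcon
  push Not at hcon
  choose ρ κ hκ using fun i => exists_eq_mk ⟨0, hm⟩ (z i H)
  obtain ⟨i, j, hij, hρ, hle⟩ : ∃ i j, i ≠ j ∧ ρ i = ρ j ∧ κ i ≤ κ j := by
    obtain ⟨i, j, hij, h⟩ := Fintype.exists_ne_map_eq_of_card_lt ρ (by simpa using hmn)
    rcases le_total (κ i) (κ j) with h' | h'
    · exact ⟨i, j, hij, h, h'⟩
    · exact ⟨j, i, hij.symm, h.symm, h'⟩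
  set r := ρ i with hr
  set u : Fin n → ℕ → ℤ := fun l a => sgn r (z l a) with hu
  have hstep : ∀ l k, 0 ≤ k → k < H → |u l k - u l (k + 1)| ≤ 1 := fun l k _ hk =>
    (hadj l k hk).sgn_le r
  have hhit : ∀ l l' a, l ≠ l' → a ≤ H → 0 ≤ u l H → u l' a ≠ u l H := by
    intro l l' a hll ha hpos heq
    obtain ⟨k, hk⟩ := Int.eq_ofNat_of_zero_le hpos
    apply hcon l l' hll a ha
    rw [eq_mk_of_sgn (hk : sgn r (z l H) = k), eq_mk_of_sgn (heq.trans hk : sgn r (z l' a) = k)]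
  have hup : ∀ l l', l ≠ l' → 0 ≤ u l H → u l' 0 ≤ u l H → u l H ≤ u l' H → False := by
    intro l l' hll hpos h1 h2
    obtain ⟨k, -, hk, h⟩ := exists_eq_of_steps (Nat.zero_le H) (hstep l') h1 h2
    exact hhit l l' k hll hk hpos h
  have hdown : ∀ l l', l ≠ l' → 0 ≤ u l H → u l H ≤ u l' 0 → u l' H ≤ u l H → False := by
    intro l l' hll hpos h1 h2
    obtain ⟨k, -, hk, h⟩ := exists_eq_of_steps' (Nat.zero_le H) (hstep l') h1 h2
    exact hhit l l' k hll hk hpos h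
  have hu0 : ∀ l l', u l 0 = u l' 0 := fun l l' => congrArg (sgn r) (h0 l l')
  have hi : u i H = κ i := by simp only [hu]; rw [hκ i, ← hr, sgn_mk]
  have hj : u j H = κ j := by simp only [hu]; rw [hκ j, ← hρ, sgn_mk]
  have hσ : u i H < u j 0 := by
    by_contra h
    exact hup i j hij (by omega) (not_lt.1 h) (by omega)
  have hbeyond : ∀ l, l ≠ i → u i H < u l H := by
    intro l hl
    by_contra h
    exact hdown i l hl.symm (by omega) (by rw [hu0 l j]; exact hσ.le) (not_lt.1 h)
  have hfar : ∀ l, l ≠ i → u i 0 < u l H := by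
    intro l hl
    by_contra h
    have := hbeyond l hl
    exact hdown l i hl (by omega) (not_lt.1 h) this.le
  obtain ⟨l, hl⟩ : ∃ l, l ∉ ({i, j} : Finset (Fin n)) := by
    by_contra h
    push Not at h
    have h1 : Finset.univ ⊆ ({i, j} : Finset (Fin n)) := fun x _ => h x
    have h2 := Finset.card_le_card h1
    rw [Finset.card_univ, Fintype.card_fin, Finset.card_pair hij] at h2
    omega
  simp only [Finset.mem_insert, Finset.mem_singleton, not_or] at hl
  have hl' := hbeyond l hl.1
  have hj' := hbeyond j hij.symm
  have e1 := hu0 l i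
  have e2 := hu0 j i
  have f1 := hfar l hl.1
  have f2 := hfar j hij.symm
  rcases le_total (u l H) (u j H) with h | h
  · exact hup l j hl.2 (by omega) (by omega) h
  · exact hup j l (Ne.symm hl.2) (by omega) (by omega) h

end Cell

namespace Spider

variable {n : ℕ} [NeZero n]

/-- The line through the centre running along leg `i` and then along leg `j`. -/
noncomputable def line (i j : Fin n) (τ : ℝ) : Spider n := if τ ≤ 0 then pt i (-τ) else pt j τ

lemma continuous_line {n : ℕ} (i j : Fin n) : Continuous (line i j) := by
  refine Continuous.if_le ((continuous_pt i).comp continuous_neg) (continuous_pt j) continuous_id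
    continuous_const ?_
  rintro x rfl
  simpa using pt_zero i j

lemma dist_line_le {n : ℕ} {i j : Fin n} (hij : i ≠ j) {σ τ : ℝ} (hσ : σ ∈ Set.Icc (-1 : ℝ) 1)
    (hτ : τ ∈ Set.Icc (-1 : ℝ) 1) : dist (line i j σ) (line i j τ) ≤ |σ - τ| := by
  obtain ⟨h1, h2⟩ := hσ
  obtain ⟨h3, h4⟩ := hτ
  unfold line
  split_ifs with h h' h'
  · rw [dist_pt_same (by linarith) (by linarith) (by linarith) (by linarith),
      show -σ - -τ = -(σ - τ) by ring, abs_neg]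
  · rw [dist_pt_ne hij (by linarith) (by linarith) (by linarith) (by linarith),
      abs_of_nonpos (by linarith)]
    exact max_le (by linarith) (by linarith)
  · rw [dist_pt_ne hij.symm (by linarith) (by linarith) (by linarith) (by linarith),
      abs_of_nonneg (by linarith)]
    exact max_le (by linarith) (by linarith)
  · rw [dist_pt_same (by linarith) (by linarith) (by linarith) (by linarith)]

lemma injOn_line {n : ℕ} {i j : Fin n} (hij : i ≠ j) : Set.InjOn (line i j) (Set.Icc (-1) 1) := by
  rintro σ ⟨h1, h2⟩ τ ⟨h3, h4⟩ h
  unfold line at h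
  split_ifs at h with h5 h6 h6
  · rcases pt_inj (by linarith) (by linarith) (by linarith) (by linarith) h with h | h <;>
      linarith [h.1, h.2]
  · rcases pt_inj (by linarith) (by linarith) (by linarith) (by linarith) h with h | h
    · exact absurd h.1 hij
    · linarith [h.1, h.2]
  · rcases pt_inj (by linarith) (by linarith) (by linarith) (by linarith) h with h | h
    · exact absurd h.1.symm hij
    · linarith [h.1, h.2]
  · rcases pt_inj (by linarith) (by linarith) (by linarith) (by linarith) h with h | h <;>
      linarith [h.1, h.2]

/-- An iterated fold is monotone along a part of a line on which its radius stays between zero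
and one half. -/
lemma rad_mem_of_line (hn : 2 ≤ n) {i j : Fin n} (hij : i ≠ j) (s : ℕ) {σ υ τ : ℝ} (h1 : -1 ≤ σ)
    (h2 : σ ≤ υ) (h3 : υ ≤ τ) (h4 : τ ≤ 1)
    (h : ∀ x ∈ Set.Icc σ τ, 0 < rad ((fold n)^[s] (line i j x)) ∧
      rad ((fold n)^[s] (line i j x)) < 1 / 2) :
    min (rad ((fold n)^[s] (line i j σ))) (rad ((fold n)^[s] (line i j τ))) ≤
        rad ((fold n)^[s] (line i j υ)) ∧
      rad ((fold n)^[s] (line i j υ)) ≤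
        max (rad ((fold n)^[s] (line i j σ))) (rad ((fold n)^[s] (line i j τ))) := by
  set q : ℝ → Spider n := fun x => (fold n)^[s] (line i j x) with hq
  have hqc : Continuous q := ((continuous_fold n).iterate s).comp (continuous_line i j)
  change ∀ x ∈ Set.Icc σ τ, 0 < rad (q x) ∧ rad (q x) < 1 / 2 at h
  change min (rad (q σ)) (rad (q τ)) ≤ rad (q υ) ∧ rad (q υ) ≤ max (rad (q σ)) (rad (q τ))
  obtain ⟨l, hl⟩ := exists_eq_pt (q σ)
  have hcσ : coord l (q σ) = rad (q σ) := by
    conv_lhs => rw [hl]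
    exact coord_pt (rad_nonneg _) (rad_le_one _)
  have hcc : Continuous fun x => coord l (q x) := (continuous_coord l).comp hqc
  have hpos : ∀ x ∈ Set.Icc σ τ, 0 ≤ coord l (q x) := by
    intro x hx
    by_contra hneg
    obtain ⟨y, hy, hy0⟩ := intermediate_value_Icc' hx.1 hcc.continuousOn
      (show (0 : ℝ) ∈ Set.Icc (coord l (q x)) (coord l (q σ)) from
        ⟨(not_le.1 hneg).le, hcσ ▸ rad_nonneg _⟩)
    have hy0 : coord l (q y) = 0 := hy0
    have e := eq_pt_of_coord hy0.ge
    have := (h y ⟨hy.1, hy.2.trans hx.2⟩).1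
    rw [e, hy0, rad_pt le_rfl zero_le_one] at this
    exact lt_irrefl _ this
  have heq : ∀ x ∈ Set.Icc σ τ, coord l (q x) = rad (q x) := by
    intro x hx
    conv_rhs => rw [eq_pt_of_coord (hpos x hx)]
    exact (rad_pt (hpos x hx) ((coord_le_rad _ _).trans (rad_le_one _))).symm
  have hne : ∀ x ∈ Set.Icc σ τ, ∀ y ∈ Set.Icc σ τ, x < y → coord l (q x) ≠ coord l (q y) := by
    intro x hx y hy hxy hc
    have e : q x = q y := by
      rw [eq_pt_of_coord (hpos x hx), hc, ← eq_pt_of_coord (hpos y hy)]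
    obtain ⟨r, hr, htip⟩ := exists_tipImage hn (continuous_line i j) (injOn_line hij) s x y
      (h1.trans hx.1) hxy (hy.2.trans h4) e
    have := (h r ⟨hx.1.trans hr.1, hr.2.trans hy.2⟩).2
    exact absurd this (not_lt.2 (half_le_rad_of_tipImage htip))
  have hinj : Set.InjOn (fun x => coord l (q x)) (Set.Icc σ τ) := by
    intro x hx y hy hc
    rcases lt_trichotomy x y with hxy | hxy | hxy
    · exact absurd hc (hne x hx y hy hxy)
    · exact hxy
    · exact absurd hc.symm (hne y hy x hx hxy)
  have mσ : σ ∈ Set.Icc σ τ := ⟨le_rfl, h2.trans h3⟩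
  have mυ : υ ∈ Set.Icc σ τ := ⟨h2, h3⟩
  have mτ : τ ∈ Set.Icc σ τ := ⟨h2.trans h3, le_rfl⟩
  rw [← heq σ mσ, ← heq τ mτ, ← heq υ mυ]
  rcases hcc.continuousOn.strictMonoOn_of_injOn_Icc' (h2.trans h3) hinj with hm | hm
  · exact ⟨min_le_of_left_le (hm.monotoneOn mσ mυ h2), le_max_of_le_right (hm.monotoneOn mυ mτ h3)⟩
  · exact ⟨min_le_of_right_le (hm.antitoneOn mυ mτ h3),
      le_max_of_le_left (hm.antitoneOn mσ mυ h2)⟩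

end Spider

namespace Spider

variable {n : ℕ} [NeZero n]

/-- A leg containing the point. -/
noncomputable def leg (x : Spider n) : Fin n := (exists_eq_pt x).choose

lemma eq_pt_leg (x : Spider n) : x = pt (leg x) (rad x) := (exists_eq_pt x).choose_spec

lemma dist_of_leg_eq {x y : Spider n} (h : leg x = leg y) : dist x y = |rad x - rad y| := by
  conv_lhs => rw [eq_pt_leg x, eq_pt_leg y, h]
  exact dist_pt_same (rad_nonneg x) (rad_le_one x) (rad_nonneg y) (rad_le_one y)

lemma dist_of_leg_ne {x y : Spider n} (h : leg x ≠ leg y) : dist x y = max (rad x) (rad y) := by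
  conv_lhs => rw [eq_pt_leg x, eq_pt_leg y]
  exact dist_pt_ne h (rad_nonneg x) (rad_le_one x) (rad_nonneg y) (rad_le_one y)

lemma dist_le_max_rad (x y : Spider n) : dist x y ≤ max (rad x) (rad y) := by
  by_cases h : leg x = leg y
  · rw [dist_of_leg_eq h, abs_le]
    have h1 := rad_nonneg x
    have h2 := rad_nonneg y
    constructor
    · linarith [le_max_right (rad x) (rad y)]
    · linarith [le_max_left (rad x) (rad y)]
  · exact (dist_of_leg_ne h).le

lemma fold_eq (x : Spider n) : fold n x = pt (Fin.ofNat n ⌊folds n * rad x + 1 / 2⌋₊)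
    (foldVal n (leg x) (folds n * rad x)) := by
  conv_lhs => rw [eq_pt_leg x]
  exact fold_pt (rad_nonneg x) (rad_le_one x)

lemma close_of_dist_fold_lt {x y : Spider n} {ε : ℝ} (h : dist (fold n x) (fold n y) < ε) :
    (⌊folds n * rad x + 1 / 2⌋₊ % n = ⌊folds n * rad y + 1 / 2⌋₊ % n ∧
      |foldVal n (leg x) (folds n * rad x) - foldVal n (leg y) (folds n * rad y)| < ε) ∨
    (foldVal n (leg x) (folds n * rad x) < ε ∧ foldVal n (leg y) (folds n * rad y) < ε) := by
  have hN := folds_pos (n := n)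
  have hx : 0 ≤ folds n * rad x := mul_nonneg hN.le (rad_nonneg x)
  have hy : 0 ≤ folds n * rad y := mul_nonneg hN.le (rad_nonneg y)
  rw [fold_eq, fold_eq] at h
  by_cases hl : ⌊folds n * rad x + 1 / 2⌋₊ % n = ⌊folds n * rad y + 1 / 2⌋₊ % n
  · left
    refine ⟨hl, ?_⟩
    rwa [show Fin.ofNat n ⌊folds n * rad x + 1 / 2⌋₊ = Fin.ofNat n ⌊folds n * rad y + 1 / 2⌋₊ from
      Fin.ext hl, dist_pt_same (foldVal_nonneg (leg x).2 hx) (foldVal_le_one (leg x).2 hx)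
        (foldVal_nonneg (leg y).2 hy) (foldVal_le_one (leg y).2 hy)] at h
  · right
    rw [dist_pt_ne (fun he => hl (congrArg Fin.val he)) (foldVal_nonneg (leg x).2 hx)
      (foldVal_le_one (leg x).2 hx) (foldVal_nonneg (leg y).2 hy)
      (foldVal_le_one (leg y).2 hy)] at h
    exact max_lt_iff.1 h

/-- The nodes of the subdivision of a line in `2 * H` steps. -/
noncomputable def node (i j : Fin n) (H u : ℕ) : Spider n := line i j (((u : ℝ) - H) / H)

lemma node_of_le {n : ℕ} {i j : Fin n} {H u : ℕ} (hu : u ≤ H) :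
    node i j H u = pt i ((H - u : ℕ) / (H : ℝ)) := by
  have : (u : ℝ) ≤ H := by exact_mod_cast hu
  rw [node, line, if_pos (div_nonpos_of_nonpos_of_nonneg (by linarith) (by positivity)),
    Nat.cast_sub hu]
  congr 1
  ring

lemma node_of_ge {n : ℕ} {i j : Fin n} {H u : ℕ} (hu : H ≤ u) :
    node i j H u = pt j ((u - H : ℕ) / (H : ℝ)) := by
  rcases hu.eq_or_lt with rfl | hu'
  · rw [node_of_le le_rfl]
    simpa using pt_zero i j
  · have : (H : ℝ) ≤ u := by exact_mod_cast hu
    rw [node, line, Nat.cast_sub hu]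
    split_ifs with h
    · rcases Nat.eq_zero_or_pos H with rfl | hH
      · simpa using pt_zero i j
      · have h1 : (H : ℝ) < u := by exact_mod_cast hu'
        have h2 : (0 : ℝ) < H := by exact_mod_cast hH
        exact absurd h (not_le.2 (div_pos (by linarith) h2))
    · rfl

lemma mem_Icc_of_le {H u : ℕ} (hH : 0 < H) (hu : u ≤ 2 * H) :
    ((u : ℝ) - H) / H ∈ Set.Icc (-1 : ℝ) 1 := by
  have h1 : (0 : ℝ) < H := by exact_mod_cast hH
  have h2 : (u : ℝ) ≤ 2 * H := by exact_mod_cast hu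
  have h3 : (0 : ℝ) ≤ u := by positivity
  constructor
  · rw [le_div_iff₀ h1]; linarith
  · rw [div_le_iff₀ h1]; linarith

section Walk

variable {m : ℕ} {i j : Fin n} {H s : ℕ} {Z : ℕ → Cell m}

/-- The labelled walk obtained from an iterated fold along a line. -/
noncomputable def labelledWalk (hn : 3 ≤ n) (hij : i ≠ j) (hH : 0 < H)
    (hsmall : ∀ x y, dist x y ≤ 1 / (H : ℝ) →
      dist ((fold n)^[s] x) ((fold n)^[s] y) < 1 / (64 * n) / folds n)
    (hadj : ∀ u < 2 * H, Cell.Adj (Z u) (Z (u + 1)))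
    (hclose : ∀ u ≤ 2 * H, ∀ v ≤ 2 * H, Cell.Adj (Z u) (Z v) →
      dist ((fold n)^[s + 1] (node i j H u)) ((fold n)^[s + 1] (node i j H v)) < 1 / (16 * n)) :
    LabelledWalk n m (2 * H) where
  p u := folds n * rad ((fold n)^[s] (node i j H u))
  j u := leg ((fold n)^[s] (node i j H u))
  z := Z
  three_le := hn
  p_nonneg u := mul_nonneg folds_pos.le (rad_nonneg _)
  j_lt u := (leg _).2
  step u hu := by
    have hN := folds_pos (n := n)
    have hH' : (0 : ℝ) < H := by exact_mod_cast hH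
    have hd := hsmall _ _ ((dist_line_le hij (mem_Icc_of_le hH hu.le) (mem_Icc_of_le hH hu)).trans
      (by
        rw [← sub_div, abs_div, abs_of_pos hH']
        push_cast
        rw [show (u : ℝ) - H - (u + 1 - H) = -1 by ring, abs_neg, abs_one]))
    rw [← mul_sub, abs_mul, abs_of_pos hN, ← lt_div_iff₀' hN]
    exact (abs_rad_sub_le _ _).trans_lt hd
  leg u hu := by
    have hN := folds_pos (n := n)
    have hH' : (0 : ℝ) < H := by exact_mod_cast hH
    have hd := hsmall _ _ ((dist_line_le hij (mem_Icc_of_le hH hu.le) (mem_Icc_of_le hH hu)).trans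
      (by
        rw [← sub_div, abs_div, abs_of_pos hH']
        push_cast
        rw [show (u : ℝ) - H - (u + 1 - H) = -1 by ring, abs_neg, abs_one]))
    by_cases hl : leg ((fold n)^[s] (node i j H u)) = leg ((fold n)^[s] (node i j H (u + 1)))
    · exact Or.inl (congrArg Fin.val hl)
    · right
      rw [← lt_div_iff₀' hN, ← lt_div_iff₀' hN, ← max_lt_iff]
      exact (dist_of_leg_ne hl).symm.trans_lt hd
  adj := hadj
  close u hu v hv huv := by
    have := hclose u hu v hv huv
    rw [Function.iterate_succ_apply', Function.iterate_succ_apply'] at this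
    exact close_of_dist_fold_lt this
  turn a u b hau hub hb hw := by
    have hN := folds_pos (n := n)
    have hN' := hundred_le_folds (n := n)
    have hn' : (3 : ℝ) ≤ n := by exact_mod_cast hn
    have hH' : (0 : ℝ) < H := by exact_mod_cast hH
    have hmono : ∀ {c d : ℕ}, c ≤ d → ((c : ℝ) - H) / H ≤ ((d : ℝ) - H) / H := by
      intro c d hcd
      have : (c : ℝ) ≤ d := by exact_mod_cast hcd
      gcongr
    have key := rad_mem_of_line (by omega) hij s (mem_Icc_of_le hH (by omega : a ≤ 2 * H)).1
      (hmono hau) (hmono hub) (mem_Icc_of_le hH hb).2 (by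
        intro x hx
        obtain ⟨hx1, hx2⟩ := hx
        rw [div_le_iff₀ hH'] at hx1
        rw [le_div_iff₀ hH'] at hx2
        have ha0 : (0 : ℝ) ≤ a := by positivity
        have hxn : 0 ≤ x * H + H := by linarith
        have f1 := Nat.floor_le hxn
        have f2 := Nat.lt_floor_add_one (x * H + H)
        set w := ⌊x * H + H⌋₊ with hwdef
        have haw : a ≤ w := Nat.le_floor (by linarith)
        have hwb : w ≤ b := by
          have : (w : ℝ) ≤ b := by linarith
          exact_mod_cast this
        have hxI : x ∈ Set.Icc (-1 : ℝ) 1 := by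
          have hb' : (b : ℝ) ≤ 2 * H := by exact_mod_cast hb
          constructor
          · by_contra h; nlinarith
          · by_contra h; nlinarith
        have hd := hsmall _ _ ((dist_line_le hij hxI
          (mem_Icc_of_le hH (hwb.trans hb))).trans (by
            rw [le_div_iff₀ hH', ← abs_of_pos hH', ← abs_mul, abs_of_pos hH', sub_mul,
              div_mul_cancel₀ _ hH'.ne', abs_le]
            constructor <;> linarith))
        have hr := (abs_rad_sub_le _ _).trans_lt hd
        have h64 : 1 / (64 * (n : ℝ)) ≤ 1 / 64 := by
          apply one_div_le_one_div_of_le <;> linarith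
        rw [lt_div_iff₀' hN, ← abs_of_pos hN, ← abs_mul, mul_sub, abs_lt] at hr
        have hww := hw w haw hwb
        simp only [node] at hww
        constructor
        · by_contra h
          nlinarith
        · by_contra h
          nlinarith)
    rw [← mul_min_of_nonneg _ _ hN.le, ← mul_max_of_nonneg _ _ hN.le]
    exact ⟨mul_le_mul_of_nonneg_left key.1 hN.le, mul_le_mul_of_nonneg_left key.2 hN.le⟩

/-- Closeness of the values at neighbouring cells descends along the folding map. -/
lemma dist_lt_of_adj (hm : m = 1 ∨ (4 ≤ n ∧ 0 < m ∧ m < n)) (hn : 3 ≤ n) (hij : i ≠ j) (hH : 0 < H)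
    (hsmall : ∀ x y, dist x y ≤ 1 / (H : ℝ) →
      dist ((fold n)^[s] x) ((fold n)^[s] y) < 1 / (64 * n) / folds n)
    (hadj : ∀ u < 2 * H, Cell.Adj (Z u) (Z (u + 1)))
    (hclose : ∀ u ≤ 2 * H, ∀ v ≤ 2 * H, Cell.Adj (Z u) (Z v) →
      dist ((fold n)^[s + 1] (node i j H u)) ((fold n)^[s + 1] (node i j H v)) < 1 / (16 * n))
    {u v : ℕ} (huv : u ≤ v) (hv : v ≤ 2 * H) (hz : Cell.Adj (Z u) (Z v)) :
    dist ((fold n)^[s] (node i j H u)) ((fold n)^[s] (node i j H v)) < 1 / (16 * n) := by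
  have hN := folds_pos (n := n)
  have hn' : (3 : ℝ) ≤ n := by exact_mod_cast hn
  have hNe : (folds n : ℝ) = 100 * n * n := by unfold folds; push_cast; ring
  set q : ℕ → Spider n := fun u => (fold n)^[s] (node i j H u) with hq
  have hsame : ∀ u v, u ≤ 2 * H → v ≤ 2 * H → Z u = Z v → dist (q u) (q v) ≤ n / folds n := by
    intro u v hu hv hz
    rcases (labelledWalk hn hij hH hsmall hadj hclose).near_of_eq hm hu hv hz with ⟨h1, h2⟩ | ⟨h1, h2⟩
    · have h1 : leg (q u) = leg (q v) := Fin.ext h1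
      have h2 : |folds n * rad (q u) - folds n * rad (q v)| ≤ n := h2
      rw [dist_of_leg_eq h1, le_div_iff₀' hN]
      rwa [← mul_sub, abs_mul, abs_of_pos hN] at h2
    · have h1 : folds n * rad (q u) ≤ n := h1
      have h2 : folds n * rad (q v) ≤ n := h2
      refine (dist_le_max_rad _ _).trans ?_
      rw [← le_div_iff₀' hN] at h1 h2
      exact max_le h1 h2
  have hstep : ∀ u, u < 2 * H → dist (q u) (q (u + 1)) < 1 / (64 * n) / folds n := by
    intro u hu
    have hH' : (0 : ℝ) < H := by exact_mod_cast hH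
    refine hsmall _ _ ((dist_line_le hij (mem_Icc_of_le hH hu.le) (mem_Icc_of_le hH hu)).trans ?_)
    rw [← sub_div, abs_div, abs_of_pos hH']
    push_cast
    rw [show (u : ℝ) - H - (u + 1 - H) = -1 by ring, abs_neg, abs_one]
  have e1 : (n : ℝ) / folds n = 1 / (100 * n) := by rw [hNe]; field_simp
  have hpos : (0 : ℝ) < 1 / n := by positivity
  change dist (q u) (q v) < 1 / (16 * n)
  have e2 : 1 / (100 * (n : ℝ)) = 1 / 100 * (1 / n) := by ring
  have e3 : 1 / (16 * (n : ℝ)) = 1 / 16 * (1 / n) := by ring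
  by_cases hzz : Z u = Z v
  · have := hsame u v (huv.trans hv) hv hzz
    rw [e1, e2] at this
    rw [e3]
    linarith
  · classical
    obtain ⟨w, hw, hmax⟩ : ∃ w, (u ≤ w ∧ w ≤ v ∧ Z w = Z u) ∧
        ∀ w', w < w' → w' ≤ v → Z w' ≠ Z u := by
      have hP : ∃ w ≤ v, u ≤ w ∧ Z w = Z u := ⟨u, huv, le_rfl, rfl⟩
      obtain ⟨w₀, hw₀, hP₀⟩ := hP
      refine ⟨Nat.findGreatest (fun w => u ≤ w ∧ Z w = Z u) v, ?_, ?_⟩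
      · have := Nat.findGreatest_spec (P := fun w => u ≤ w ∧ Z w = Z u) hw₀ hP₀
        exact ⟨this.1, Nat.findGreatest_le _, this.2⟩
      · intro w' h1 h2 h3
        have h4 := Nat.findGreatest_spec (P := fun w => u ≤ w ∧ Z w = Z u) hw₀ hP₀
        exact Nat.findGreatest_is_greatest h1 h2 ⟨h4.1.trans h1.le, h3⟩
    have hwv : w < v := lt_of_le_of_ne hw.2.1 (by rintro rfl; exact hzz hw.2.2.symm)
    have hzw : Z (w + 1) = Z v := Cell.eq_of_walk_avoiding (c := Z u) (Nat.succ_le_of_lt hwv)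
      (fun k _ hk => hadj k (by omega)) (fun k hk hk' => hmax k hk hk')
      (hw.2.2 ▸ hadj w (by omega)) hz
    have d1 := hsame u w (by omega) (by omega) hw.2.2.symm
    have d2 := hstep w (by omega)
    have d3 := hsame (w + 1) v (by omega) (by omega) hzw
    have d4 := dist_triangle4 (q u) (q w) (q (w + 1)) (q v)
    have d5 : 1 / (64 * (n : ℝ)) / folds n ≤ 1 / (64 * n) := by
      apply div_le_self (by positivity)
      have := hundred_le_folds (n := n)
      linarith
    have e4 : 1 / (64 * (n : ℝ)) = 1 / 64 * (1 / n) := by ring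
    rw [e1, e2] at d1 d3
    rw [e4] at d5
    rw [e4] at d2
    rw [e3]
    linarith

end Walk

end Spider

namespace Cell

lemma adj_mk {m : ℕ} (r : Fin m) {k k' : ℕ} (h1 : k ≤ k' + 1) (h2 : k' ≤ k + 1) :
    Adj (mk r k) (mk r k') := by
  rcases lt_trichotomy k k' with h | rfl | h
  · obtain rfl : k' = k + 1 := by omega
    exact Or.inr ⟨r, k, Or.inl ⟨rfl, rfl⟩⟩
  · exact Adj.refl _
  · obtain rfl : k = k' + 1 := by omega
    exact Or.inr ⟨r, k', Or.inr ⟨rfl, rfl⟩⟩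

end Cell

namespace Spider

variable {n : ℕ} [NeZero n]

/-- The map of the nodes of a subdivided spider to cells cannot be compatible with iterated folds. -/
lemma not_close_iterate_fold {m H k : ℕ} (hm : m = 1 ∨ (4 ≤ n ∧ 0 < m ∧ m < n)) (hn : 3 ≤ n)
    (hH : 0 < H)
    (hsmall : ∀ s < k, ∀ x y, dist x y ≤ 1 / (H : ℝ) →
      dist ((fold n)^[s] x) ((fold n)^[s] y) < 1 / (64 * n) / folds n)
    {z : Fin n → ℕ → Cell m} (h0 : ∀ i j, z i 0 = z j 0)
    (hadj : ∀ i, ∀ a < H, Cell.Adj (z i a) (z i (a + 1)))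
    (hclose : ∀ i j, ∀ a ≤ H, ∀ b ≤ H, Cell.Adj (z i a) (z j b) →
      dist ((fold n)^[k] (pt i (a / (H : ℝ)))) ((fold n)^[k] (pt j (b / (H : ℝ)))) < 1 / (16 * n)) :
    False := by
  have hH' : (0 : ℝ) < H := by exact_mod_cast hH
  have hn' : (3 : ℝ) ≤ n := by exact_mod_cast hn
  have key : ∀ d s, s + d = k → ∀ i j, ∀ a ≤ H, ∀ b ≤ H, Cell.Adj (z i a) (z j b) →
      dist ((fold n)^[s] (pt i (a / (H : ℝ)))) ((fold n)^[s] (pt j (b / (H : ℝ)))) <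
        1 / (16 * n) := by
    intro d
    induction d with
    | zero =>
      rintro s rfl
      exact hclose
    | succ d ih =>
      intro s hs
      have ih := ih (s + 1) (by omega)
      have hline : ∀ i j, i ≠ j → ∀ u ≤ 2 * H, ∀ v ≤ 2 * H,
          Cell.Adj (if u ≤ H then z i (H - u) else z j (u - H))
            (if v ≤ H then z i (H - v) else z j (v - H)) →
          dist ((fold n)^[s] (node i j H u)) ((fold n)^[s] (node i j H v)) < 1 / (16 * n) := by
        intro i j hij
        have hrep : ∀ u ≤ 2 * H, ∃ l a, a ≤ H ∧ node i j H u = pt l (a / (H : ℝ)) ∧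
            (if u ≤ H then z i (H - u) else z j (u - H)) = z l a := by
          intro u hu
          by_cases h : u ≤ H
          · exact ⟨i, H - u, by omega, node_of_le h, if_pos h⟩
          · exact ⟨j, u - H, by omega, node_of_ge (by omega), if_neg h⟩
        have hZ : ∀ u < 2 * H, Cell.Adj (if u ≤ H then z i (H - u) else z j (u - H))
            (if u + 1 ≤ H then z i (H - (u + 1)) else z j (u + 1 - H)) := by
          intro u hu
          rcases lt_trichotomy u H with h | rfl | h
          · rw [if_pos h.le, if_pos (by omega)]
            have := (hadj i (H - (u + 1)) (by omega)).symm
            rwa [show H - (u + 1) + 1 = H - u by omega] at this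
          · rw [if_pos le_rfl, if_neg (by omega), Nat.sub_self, h0 i j, Nat.add_sub_cancel_left]
            exact hadj j 0 hH
          · rw [if_neg (by omega), if_neg (by omega), show u + 1 - H = (u - H) + 1 by omega]
            exact hadj j _ (by omega)
        have hcl : ∀ u ≤ 2 * H, ∀ v ≤ 2 * H,
            Cell.Adj (if u ≤ H then z i (H - u) else z j (u - H))
              (if v ≤ H then z i (H - v) else z j (v - H)) →
            dist ((fold n)^[s + 1] (node i j H u)) ((fold n)^[s + 1] (node i j H v)) <
              1 / (16 * n) := by
          intro u hu v hv huv
          obtain ⟨l, a, ha, e1, e2⟩ := hrep u hu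
          obtain ⟨l', b, hb, e3, e4⟩ := hrep v hv
          rw [e2, e4] at huv
          rw [e1, e3]
          exact ih l l' a ha b hb huv
        intro u hu v hv huv
        rcases le_total u v with h | h
        · exact dist_lt_of_adj hm hn hij hH (hsmall s (by omega))
            (Z := fun u => if u ≤ H then z i (H - u) else z j (u - H)) hZ hcl h hv huv
        · rw [dist_comm]
          exact dist_lt_of_adj hm hn hij hH (hsmall s (by omega))
            (Z := fun u => if u ≤ H then z i (H - u) else z j (u - H)) hZ hcl h hu huv.symm
      intro i j a ha b hb hab
      have eleft : ∀ j a, a ≤ H → node i j H (H - a) = pt i (a / (H : ℝ)) := by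
        intro j a ha
        rw [node_of_le (by omega), show H - (H - a) = a by omega]
      by_cases hij : i = j
      · subst hij
        obtain ⟨l, hl⟩ : ∃ l, i ≠ l := by
          have : Nontrivial (Fin n) := Fin.nontrivial_iff_two_le.2 (by omega)
          obtain ⟨l, hl⟩ := exists_ne i
          exact ⟨l, hl.symm⟩
        have := hline i l hl (H - a) (by omega) (H - b) (by omega) (by
          rw [if_pos (by omega), if_pos (by omega), show H - (H - a) = a by omega,
            show H - (H - b) = b by omega]
          exact hab)
        rwa [eleft l a ha, eleft l b hb] at this
      · have eright : (if H + b ≤ H then z i (H - (H + b)) else z j (H + b - H)) = z j b := by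
          split_ifs with h
          · obtain rfl : b = 0 := by omega
            simpa using h0 i j
          · rw [Nat.add_sub_cancel_left]
        have := hline i j hij (H - a) (by omega) (H + b) (by omega) (by
          rw [if_pos (by omega), show H - (H - a) = a by omega, eright]
          exact hab)
        rwa [eleft j a ha, node_of_ge (by omega), Nat.add_sub_cancel_left] at this
  have hmpos : 0 < m ∧ m < n := by
    rcases hm with rfl | hm
    · exact ⟨one_pos, by omega⟩
    · exact hm.2
  obtain ⟨i, j, hij, a, ha, hz⟩ := Cell.exists_end_eq hn hmpos.1 hmpos.2 h0 hadj
  have hlt := key k 0 (by omega) i j H le_rfl a ha (Or.inl hz)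
  have ha' : (a : ℝ) ≤ H := by exact_mod_cast ha
  rw [Function.iterate_zero, id, id, div_self hH'.ne', dist_pt_ne hij zero_le_one le_rfl
    (by positivity) ((div_le_one hH').2 ha')] at hlt
  have h1 := le_max_left (1 : ℝ) (a / H)
  have h2 : 1 / (16 * (n : ℝ)) ≤ 1 / 1 := one_div_le_one_div_of_le one_pos (by linarith)
  linarith

/-- A decomposition of a space into cells of a discrete spider with small neighbouring cells. -/
def HasCells (m : ℕ) (Y : Type*) [MetricSpace Y] : Prop :=
  ∀ δ > 0, ∃ c : Y → Cell m, (∃ ρ > 0, ∀ y y', dist y y' < ρ → Cell.Adj (c y) (c y')) ∧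
    ∀ y y', Cell.Adj (c y) (c y') → dist y y' < δ

lemma floor_near {a b : ℝ} (ha : 0 ≤ a) (h : |a - b| < 1) : ⌊a⌋₊ ≤ ⌊b⌋₊ + 1 := by
  have h1 := Nat.floor_le ha
  have h2 := Nat.lt_floor_add_one b
  rw [abs_lt] at h
  have : (⌊a⌋₊ : ℝ) < ⌊b⌋₊ + 1 + 1 := by linarith
  have : ⌊a⌋₊ < ⌊b⌋₊ + 1 + 1 := by exact_mod_cast this
  omega

lemma hasCells (m : ℕ) [NeZero m] : HasCells m (Spider m) := by
  intro δ hδ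
  obtain ⟨Q, hQ⟩ := exists_nat_gt (2 / δ)
  have hQ0 : (0 : ℝ) < Q := (by positivity : (0 : ℝ) < 2 / δ).trans hQ
  have hQδ : 2 / Q < δ := (div_lt_comm₀ hδ hQ0).1 hQ
  have hnn : ∀ y : Spider m, 0 ≤ Q * rad y := fun y => mul_nonneg hQ0.le (rad_nonneg y)
  refine ⟨fun y => Cell.mk (leg y) ⌊Q * rad y⌋₊, ⟨1 / Q, by positivity, fun y y' h => ?_⟩,
    fun y y' h => ?_⟩
  · by_cases hl : leg y = leg y'
    · rw [dist_of_leg_eq hl, lt_div_iff₀' hQ0] at h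
      have h' : |Q * rad y - Q * rad y'| < 1 := by rwa [← mul_sub, abs_mul, abs_of_pos hQ0]
      simp only [hl]
      exact Cell.adj_mk _ (floor_near (hnn y) h') (floor_near (hnn y') (by rwa [abs_sub_comm]))
    · rw [dist_of_leg_ne hl, max_lt_iff, lt_div_iff₀' hQ0, lt_div_iff₀' hQ0] at h
      simp only [Nat.floor_eq_zero.2 h.1, Nat.floor_eq_zero.2 h.2]
      exact Cell.Adj.refl _
  · refine lt_trans ?_ hQδ
    rw [lt_div_iff₀' hQ0]
    have h1 := Nat.floor_le (hnn y)
    have h2 := Nat.lt_floor_add_one (Q * rad y)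
    have h3 := Nat.floor_le (hnn y')
    have h4 := Nat.lt_floor_add_one (Q * rad y')
    have hs := h.sgn_le (leg y)
    by_cases hl : leg y = leg y'
    · rw [dist_of_leg_eq hl, ← abs_of_pos hQ0, ← abs_mul, mul_sub, abs_lt]
      simp only [← hl, Cell.sgn_mk] at hs
      have hs' : |((⌊Q * rad y⌋₊ : ℤ) : ℝ) - (⌊Q * rad y'⌋₊ : ℤ)| ≤ 1 := by exact_mod_cast hs
      rw [abs_le] at hs'
      push_cast at hs'
      constructor <;> linarith
    · simp only [Cell.sgn_mk, Cell.sgn_mk_ne (Ne.symm hl)] at hs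
      have hs' : |((⌊Q * rad y⌋₊ : ℤ) : ℝ) - (-(⌊Q * rad y'⌋₊ : ℤ) : ℤ)| ≤ 1 := by
        exact_mod_cast hs
      rw [abs_le] at hs'
      push_cast at hs'
      rw [dist_of_leg_ne hl, mul_max_of_nonneg _ _ hQ0.le]
      have g1 : (0 : ℝ) ≤ ⌊Q * rad y⌋₊ := by positivity
      have g2 : (0 : ℝ) ≤ ⌊Q * rad y'⌋₊ := by positivity
      exact max_lt (by linarith) (by linarith)

lemma exists_dist_lt_of_fibre {K A B : Type*} [MetricSpace K] [CompactSpace K] [MetricSpace A]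
    [MetricSpace B] {u : K → A} {v : K → B} (hu : Continuous u) (hv : Continuous v) {η : ℝ}
    (h : ∀ x y, u x = u y → dist (v x) (v y) < η) :
    ∃ δ > 0, ∀ x y, dist (u x) (u y) < δ → dist (v x) (v y) < η := by
  have hF : IsClosed {p : K × K | η ≤ dist (v p.1) (v p.2)} := isClosed_le continuous_const
    ((hv.comp continuous_fst).dist (hv.comp continuous_snd))
  rcases Set.eq_empty_or_nonempty {p : K × K | η ≤ dist (v p.1) (v p.2)} with he | hne
  · refine ⟨1, one_pos, fun x y _ => ?_⟩
    by_contra hxy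
    have : (x, y) ∈ {p : K × K | η ≤ dist (v p.1) (v p.2)} := not_lt.1 hxy
    rw [he] at this
    exact this
  · obtain ⟨q, hq, hmin⟩ := hF.isCompact.exists_isMinOn hne
      ((hu.comp continuous_fst).dist (hu.comp continuous_snd)).continuousOn
    refine ⟨_, dist_pos.2 fun he => not_lt.2 hq (h q.1 q.2 he), fun x y hxy => ?_⟩
    by_contra hxy'
    exact absurd hxy (not_lt.2 (hmin (show (x, y) ∈ {p : K × K | η ≤ dist (v p.1) (v p.2)} from
      not_lt.1 hxy')))

lemma hasCells_two : HasCells 1 (Spider 2) := by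
  intro δ hδ
  have hc1 : ∀ y : Spider 2, coord 1 y = -coord 0 y := by
    intro y
    simp only [coord, rad, Fin.sum_univ_two]
    ring
  have hinj : ∀ y y' : Spider 2, coord 0 y = coord 0 y' → y = y' := by
    intro y y' h
    rcases le_total 0 (coord 0 y) with h0 | h0
    · rw [eq_pt_of_coord h0, h, ← eq_pt_of_coord (h ▸ h0)]
    · have h1 : 0 ≤ coord 1 y := by rw [hc1]; linarith
      have h2 : coord 1 y = coord 1 y' := by rw [hc1, hc1, h]
      rw [eq_pt_of_coord h1, h2, ← eq_pt_of_coord (h2 ▸ h1)]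
  obtain ⟨β, hβ, hβδ⟩ := exists_dist_lt_of_fibre (continuous_coord (0 : Fin 2))
    (continuous_id (X := Spider 2)) (η := δ) (fun x y h => by rw [hinj x y h, dist_self]; exact hδ)
  obtain ⟨Q, hQ⟩ := exists_nat_gt (2 / β)
  have hQ0 : (0 : ℝ) < Q := (by positivity : (0 : ℝ) < 2 / β).trans hQ
  have hQβ : 2 / Q < β := (div_lt_comm₀ hβ hQ0).1 hQ
  have hnn : ∀ y : Spider 2, 0 ≤ Q * (1 + coord 0 y) := fun y => by
    have h1 := (coord_le_rad 1 y).trans (rad_le_one y)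
    rw [hc1] at h1
    exact mul_nonneg hQ0.le (by linarith)
  obtain ⟨ρ, hρ, hρ'⟩ := Metric.uniformContinuous_iff.1
    (CompactSpace.uniformContinuous_of_continuous (continuous_coord (0 : Fin 2))) (1 / Q)
    (by positivity)
  refine ⟨fun y => Cell.mk 0 ⌊Q * (1 + coord 0 y)⌋₊, ⟨ρ, hρ, fun y y' h => ?_⟩, fun y y' h => ?_⟩
  · have h := hρ' h
    rw [Real.dist_eq, lt_div_iff₀' hQ0] at h
    have h' : |Q * (1 + coord 0 y) - Q * (1 + coord 0 y')| < 1 := by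
      rwa [← mul_sub, abs_mul, abs_of_pos hQ0, add_sub_add_left_eq_sub]
    exact Cell.adj_mk _ (floor_near (hnn y) h') (floor_near (hnn y') (by rwa [abs_sub_comm]))
  · refine hβδ y y' (lt_trans ?_ hQβ)
    rw [lt_div_iff₀' hQ0]
    have h1 := Nat.floor_le (hnn y)
    have h2 := Nat.lt_floor_add_one (Q * (1 + coord 0 y))
    have h3 := Nat.floor_le (hnn y')
    have h4 := Nat.lt_floor_add_one (Q * (1 + coord 0 y'))
    have hs := h.sgn_le 0
    simp only [Cell.sgn_mk] at hs
    have hs' : |((⌊Q * (1 + coord 0 y)⌋₊ : ℤ) : ℝ) - (⌊Q * (1 + coord 0 y')⌋₊ : ℤ)| ≤ 1 := by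
      exact_mod_cast hs
    rw [Real.dist_eq, ← abs_of_pos hQ0, ← abs_mul, mul_sub, abs_lt]
    rw [abs_le] at hs'
    push_cast at hs'
    constructor <;> linarith

end Spider

namespace Spider

variable {n : ℕ} [NeZero n]

lemma not_isLike {K : Type*} [MetricSpace K] [CompactSpace K] {π : ℕ → K → Spider n}
    (h : IsInverseLimit (fold n) π) (hn : 3 ≤ n) {m : ℕ} (hm : m = 1 ∨ (4 ≤ n ∧ 0 < m ∧ m < n))
    {X Y : Type*} [MetricSpace X] [CompactSpace X] [MetricSpace Y] (hX : HasCells m X)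
    (e : X ≃ₜ Y) : ¬ IsLike K Y := by
  intro hK
  have hn0 : (0 : ℝ) < n := by exact_mod_cast (by omega : 0 < n)
  have hη : 0 < 1 / (16 * (n : ℝ)) := by positivity
  have hζ : 0 < 1 / (64 * (n : ℝ)) / folds n := div_pos (by positivity) folds_pos
  obtain ⟨ε, hε, hπ⟩ := Metric.uniformContinuous_iff.1
    (CompactSpace.uniformContinuous_of_continuous (h.continuous 0)) _ hη
  obtain ⟨g, hg, -, hdiam⟩ := hK ε hε
  have hu : Continuous (e.symm ∘ g) := e.symm.continuous.comp hg
  obtain ⟨δ, hδ, hfib⟩ := exists_dist_lt_of_fibre hu (h.continuous 0) (fun x y hxy =>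
    hπ ((Metric.dist_le_diam_of_mem
      (isCompact_univ.isBounded.subset (Set.subset_univ (g ⁻¹' {g y})))
      (show x ∈ g ⁻¹' {g y} from e.symm.injective hxy) (show y ∈ g ⁻¹' {g y} from rfl)).trans_lt
        (hdiam (g y))))
  obtain ⟨c, ⟨ρ, hρ, hcadj⟩, hcdist⟩ := hX δ hδ
  obtain ⟨ε', hε', hu'⟩ := Metric.uniformContinuous_iff.1
    (CompactSpace.uniformContinuous_of_continuous hu) ρ hρ
  obtain ⟨k, δ', hδ', hk⟩ := h.exists_dist_lt hε'
  obtain ⟨δ'', hδ'', hit⟩ := Metric.uniformContinuous_iff.1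
    (CompactSpace.uniformContinuous_of_continuous
      (continuous_pi fun s : Fin k => (continuous_fold n).iterate s)) _ hζ
  obtain ⟨H, hH⟩ := exists_nat_one_div_lt (lt_min hδ' hδ'')
  rw [← Nat.cast_succ, lt_min_iff] at hH
  obtain ⟨σ, hσ⟩ := (h.surj k).hasRightInverse
  have hH0 : (0 : ℝ) < (H.succ : ℝ) := by positivity
  refine not_close_iterate_fold (H := H.succ) (k := k)
    (z := fun i a => c (e.symm (g (σ (pt i (a / (H.succ : ℝ))))))) hm hn H.succ_pos
    (fun s hs x y hxy => (dist_pi_lt_iff hζ).1 (hit (hxy.trans_lt hH.2)) ⟨s, hs⟩)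
    (fun i j => ?_) (fun i a ha => ?_) (fun i j a ha b hb hab => ?_)
  · simp only [Nat.cast_zero, zero_div, pt_zero i j]
  · have ha' : (a : ℝ) + 1 ≤ (H.succ : ℝ) := by exact_mod_cast ha
    refine hcadj _ _ (hu' (hk _ _ ?_))
    rw [hσ, hσ, dist_pt_same]
    · refine lt_of_eq_of_lt ?_ hH.1
      rw [← sub_div, Nat.cast_succ a, sub_add_cancel_left, abs_div, abs_neg, abs_one,
        abs_of_pos hH0]
    · positivity
    · exact (div_le_one hH0).2 (by linarith)
    · positivity
    · exact (div_le_one hH0).2 (by rwa [Nat.cast_succ])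
  · have := hfib _ _ (hcdist _ _ hab)
    rwa [← h.iterate 0 k, ← h.iterate 0 k, Nat.zero_add, hσ, hσ] at this

end Spider

/-- For every integer `n ≥ 3` there is an atriodic continuum which is
simple-`n`-od-like but not simple-`(n-1)`-od-like. -/
theorem statement5 (n : ℕ) (hn : 3 ≤ n) :
    ∃ (K : Type) (_ : MetricSpace K), CompactSpace K ∧ ConnectedSpace K ∧ Nonempty K ∧
      AtriodicSpace K ∧ IsLike K (simpleOdSet n) ∧ ¬ IsLike K (simpleOdSet (n - 1)) := by
  have : NeZero n := ⟨by omega⟩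
  obtain ⟨K, _, π, hK, h⟩ :=
    IsInverseLimit.exists_of_surjective (Spider.continuous_fold n) (Spider.surjective_fold n)
  have hconn : ConnectedSpace K := h.connectedSpace
  refine ⟨K, inferInstance, hK, hconn, hconn.toNonempty, Spider.atriodicSpace h,
    h.isLike (Spider.homeo n), ?_⟩
  rcases hn.eq_or_lt with rfl | hn'
  · exact Spider.not_isLike h hn (.inl rfl) Spider.hasCells_two (Spider.homeo 2)
  · have : NeZero (n - 1) := ⟨by omega⟩
    exact Spider.not_isLike h hn (.inr ⟨hn', by omega, by omega⟩) (Spider.hasCells (n - 1))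
      (Spider.homeo (n - 1))
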